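/- arXiv:2207.03591 — 2 statements merged into one kernel-verified Lean document; each statement's English description precedes it below -/
import Mathlib

section
/- Let V : ℝ × ℝ² → ℝ be a C¹ function which is C² and harmonic in the pair of variables q = (x,y) (for each fixed u), and which is polynomially u-bounded. Then every maximal solution of the non-autonomous system q̈(u) = -∇_q V(u, q(u)) is defined on all of ℝ if and only if, for each u ∈ ℝ, the function V(u,·) : ℝ² → ℝ is a polynomial of degree at most 2 in (x,y). -/
open Set

noncomputable section

/-- The Euclidean plane. -/
abbrev E2 := EuclideanSpace ℝ (Fin 2)

/-- A function `V : ℝ² → ℝ` is harmonic if its Laplacian vanishes identically. -/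
def Harmonic2 (V : E2 → ℝ) : Prop :=
  ∀ p : E2, ∑ i : Fin 2,
    fderiv ℝ (fun q => fderiv ℝ V q (EuclideanSpace.single i 1)) p
      (EuclideanSpace.single i 1) = 0

/-- `V : ℝ × ℝ² → ℝ` is polynomially `u`-bounded: near each `u₀` there is a
polynomial upper bound, uniform in `u`. -/
def PolynomiallyUBounded (V : ℝ → E2 → ℝ) : Prop :=
  ∀ u₀ : ℝ, ∃ ε > (0 : ℝ), ∃ P : MvPolynomial (Fin 2) ℝ,
    ∀ u : ℝ, ∀ q : E2, |u - u₀| < ε →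
      V u q ≤ MvPolynomial.eval (fun i => q i) P

/-- `q` (with velocity `v`) solves the second-order ODE `q̈(u) = F (u, q(u))`
on the set `s`. -/
def SolOn (F : ℝ → E2 → E2) (q v : ℝ → E2) (s : Set ℝ) : Prop :=
  ∀ t ∈ s, HasDerivAt q (v t) t ∧ HasDerivAt v (F t (q t)) t

/-- `q` (with velocity `v`) is a maximal solution of `q̈(u) = F (u, q(u))` on
the open interval `s`. -/
def IsMaximalSolution (F : ℝ → E2 → E2) (q v : ℝ → E2) (s : Set ℝ) : Prop :=
  IsOpen s ∧ s.OrdConnected ∧ s.Nonempty ∧ SolOn F q v s ∧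
  ∀ (s' : Set ℝ) (q' v' : ℝ → E2), IsOpen s' → s'.OrdConnected → s ⊆ s' →
    SolOn F q' v' s' → (∀ t ∈ s, q' t = q t ∧ v' t = v t) → s' = s

/-- Coefficient estimate for an entire function whose real part is bounded above on a disc. -/
theorem norm_iteratedDeriv_le_of_re_le {f : ℂ → ℂ} (hf : Differentiable ℂ f) {R M : ℝ}
    (hR : 0 < R) (hM : 0 < M) (h0 : f 0 = 0) (hre : ∀ z, ‖z‖ < R → (f z).re ≤ M) (n : ℕ) :
    ‖iteratedDeriv n f 0‖ ≤ n.factorial * (2 * M) / (R / 2) ^ n := by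
  refine Complex.norm_iteratedDeriv_le_of_forall_mem_sphere_norm_le n (by positivity)
    hf.diffContOnCl fun z hz => ?_
  have hz' : ‖z‖ = R / 2 := by simpa using hz
  have := Complex.borelCaratheodory_zero hM hf.differentiableOn
    (fun z hz => hre z (by simpa using hz)) hR (z := z) (by simp [hz']; linarith) h0
  rw [hz'] at this
  refine this.trans (le_of_eq ?_)
  field_simp
  ring

theorem iteratedDeriv_polynomial_eval (p : Polynomial ℂ) (n : ℕ) :
    iteratedDeriv n (fun z => p.eval z) 0 = n.factorial * p.coeff n := by
  have h : ∀ n : ℕ, iteratedDeriv n (fun z => p.eval z) =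
      fun z => (Polynomial.derivative^[n] p).eval z := by
    intro n
    induction n with
    | zero => simp
    | succ n ih =>
      rw [iteratedDeriv_succ, ih]
      ext z
      rw [Function.iterate_succ_apply', Polynomial.deriv]
  rw [h n]
  simp only [← Polynomial.coeff_zero_eq_eval_zero, Polynomial.coeff_iterate_derivative]
  simp [Nat.descFactorial_self]

/-- The coefficients of a complex polynomial are controlled by its real part on the unit disc. -/
theorem norm_coeff_le_of_abs_re_eval_le {p : Polynomial ℂ} {M : ℝ} (h0 : (p.coeff 0).im = 0)
    (hM : ∀ z : ℂ, ‖z‖ ≤ 1 → |(p.eval z).re| ≤ M) (n : ℕ) :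
    ‖p.coeff n‖ ≤ 2 ^ (n + 2) * M := by
  have hM0 : 0 ≤ M := (abs_nonneg _).trans (hM 0 (by simp))
  have hp0 : ‖p.coeff 0‖ ≤ M := by
    have := hM 0 (by simp)
    rw [← Polynomial.coeff_zero_eq_eval_zero] at this
    rwa [← Complex.re_add_im (p.coeff 0), h0, Complex.ofReal_zero, zero_mul, add_zero,
      Complex.norm_real]
  rcases Nat.eq_zero_or_pos n with rfl | hn
  · refine hp0.trans ?_
    norm_num
    linarith
  · refine le_of_forall_pos_le_add fun ε hε => ?_
    set η := ε / 2 ^ (n + 1) with hη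
    have hη0 : 0 < η := by positivity
    set q := p - Polynomial.C (p.coeff 0) with hq
    have h := norm_iteratedDeriv_le_of_re_le (f := fun z => q.eval z) q.differentiable
      (R := 1) (M := 2 * M + η) one_pos (by positivity)
      (by simp [hq, Polynomial.coeff_zero_eq_eval_zero])
      (fun z hz => by
        have h1 := (abs_le.1 (hM z hz.le)).2
        have h2 := (abs_le.1 ((Complex.abs_re_le_norm _).trans hp0)).1
        simp only [hq, Polynomial.eval_sub, Polynomial.eval_C, Complex.sub_re]
        linarith) n
    rw [iteratedDeriv_polynomial_eval, hq, Polynomial.coeff_sub, Polynomial.coeff_C,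
      if_neg hn.ne', sub_zero, norm_mul, Complex.norm_natCast] at h
    have hf : (0 : ℝ) < n.factorial := by exact_mod_cast n.factorial_pos
    rw [mul_div_assoc] at h
    refine (le_of_mul_le_mul_left h hf).trans (le_of_eq ?_)
    rw [hη, one_div, inv_pow, div_inv_eq_mul]
    field_simp
    ring

/-- A harmonic function on `ℂ` bounded above by `C (1 + |z|) ^ N` is the real part of a
polynomial of degree at most `N`. -/
theorem exists_polynomial_re_eq_of_le {W : ℂ → ℝ}
    (hW : InnerProductSpace.HarmonicOnNhd W univ) {C : ℝ} {N : ℕ}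
    (hC : ∀ z, W z ≤ C * (1 + ‖z‖) ^ N) :
    ∃ p : Polynomial ℂ, p.natDegree ≤ N ∧ (p.coeff 0).im = 0 ∧ ∀ z, W z = (p.eval z).re := by
  obtain ⟨F, hF, rfl⟩ := hW.exists_analyticOnNhd_univ_re_eq
  have hFd : Differentiable ℂ F := fun z => (hF z (mem_univ z)).differentiableAt
  set g : ℂ → ℂ := fun z => F z - F 0 with hg
  have hgd : Differentiable ℂ g := hFd.sub_const _
  set D := max C 0 + |(F 0).re| + 1 with hD
  have hD0 : 0 < D := by positivity
  have hge : ∀ z, (g z).re ≤ D * (1 + ‖z‖) ^ N := by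
    intro z
    have h1 : 1 ≤ (1 + ‖z‖) ^ N := one_le_pow₀ (by linarith [norm_nonneg z])
    have h2 := hC z
    have h3 := neg_abs_le (F 0).re
    have h4 : C ≤ max C 0 := le_max_left _ _
    simp only [hg, Complex.sub_re]
    nlinarith [abs_nonneg (F 0).re, mul_le_mul_of_nonneg_right h4 (zero_le_one.trans h1),
      mul_le_mul_of_nonneg_left h1 (abs_nonneg (F 0).re)]
  have hz : ∀ n, N < n → iteratedDeriv n g 0 = 0 := by
    intro n hn
    have hb : ∀ R : ℝ, 1 ≤ R → ‖iteratedDeriv n g 0‖ ≤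
        n.factorial * (2 * (D * 2 ^ N)) * 2 ^ n * R⁻¹ := by
      intro R hR
      have hR0 : 0 < R := by linarith
      refine (norm_iteratedDeriv_le_of_re_le hgd (R := R) (M := D * (2 * R) ^ N) hR0
        (by positivity) (by simp [hg]) (fun z hz => (hge z).trans ?_) n).trans ?_
      · gcongr
        linarith
      · obtain ⟨k, rfl⟩ : ∃ k, n = N + 1 + k := ⟨n - (N + 1), by omega⟩
        have : R ^ (N + 1) ≤ R ^ (N + 1 + k) := pow_le_pow_right₀ hR (by omega)
        rw [mul_pow, div_pow, div_div_eq_mul_div, div_le_iff₀ (by positivity)]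
        calc _ = (N + 1 + k).factorial * (2 * (D * 2 ^ N)) * 2 ^ (N + 1 + k) * R⁻¹
              * R ^ (N + 1) := by field_simp; ring
          _ ≤ _ := by gcongr
    have hlim : Filter.Tendsto (fun R : ℝ => n.factorial * (2 * (D * 2 ^ N)) * 2 ^ n * R⁻¹)
        Filter.atTop (nhds 0) := by
      simpa using tendsto_inv_atTop_zero.const_mul
        ((n.factorial : ℝ) * (2 * (D * 2 ^ N)) * 2 ^ n)
    have := ge_of_tendsto hlim (Filter.eventually_atTop.2 ⟨1, hb⟩)
    exact norm_le_zero_iff.1 this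
  refine ⟨Polynomial.C ((F 0).re : ℂ) + ∑ n ∈ Finset.range (N + 1),
    Polynomial.C ((n.factorial : ℂ)⁻¹ * iteratedDeriv n g 0) * Polynomial.X ^ n, ?_, ?_, ?_⟩
  · refine Polynomial.natDegree_add_le_of_degree_le (by simp)
      (Polynomial.natDegree_sum_le_of_forall_le _ _ fun n hn => ?_)
    exact (Polynomial.natDegree_C_mul_X_pow_le _ _).trans
      (by have := Finset.mem_range.1 hn; omega)
  · simp [Polynomial.coeff_X_pow, hg]
  · intro z
    have h := Complex.hasSum_taylorSeries_of_entire hgd 0 z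
    have h' := (hasSum_sum_of_ne_finset_zero (L := .unconditional ℕ) (s := Finset.range (N + 1))
      (f := fun n : ℕ => (n.factorial : ℂ)⁻¹ • (z - 0) ^ n • iteratedDeriv n g 0)
      (fun n hn => by rw [hz n (by simpa using hn)]; simp))
    have e := h.unique h'
    have : F z = F 0 + g z := by simp [hg]
    simp only [this, e, Polynomial.eval_add, Polynomial.eval_C, Polynomial.eval_finsetSum,
      Complex.add_re, Complex.ofReal_re, Polynomial.eval_mul, Polynomial.eval_pow,
      Polynomial.eval_X]
    congr 2
    refine Finset.sum_congr rfl fun n _ => ?_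
    simp only [smul_eq_mul, sub_zero]
    ring

/-- The standard isometry between the Euclidean plane and `ℂ`. -/
def toC : E2 ≃ₗᵢ[ℝ] ℂ := Complex.orthonormalBasisOneI.repr.symm

theorem toC_symm_one : toC.symm 1 = EuclideanSpace.single 0 1 := by
  ext i
  fin_cases i <;> simp [toC, Complex.orthonormalBasisOneI_repr_apply]

theorem toC_symm_I : toC.symm Complex.I = EuclideanSpace.single 1 1 := by
  ext i
  fin_cases i <;> simp [toC, Complex.orthonormalBasisOneI_repr_apply]

theorem Harmonic2.harmonicOnNhd_comp_toC_symm {W : E2 → ℝ} (hW : ContDiff ℝ 2 W)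
    (hh : Harmonic2 W) :
    InnerProductSpace.HarmonicOnNhd (W ∘ toC.symm) univ := by
  have hc : ContDiff ℝ 2 (W ∘ toC.symm) := hW.comp toC.symm.contDiff
  have hd : ∀ z e, fderiv ℝ (W ∘ toC.symm) z e = fderiv ℝ W (toC.symm z) (toC.symm e) := by
    intro z e
    rw [fderiv_comp z (hW.differentiable two_ne_zero _) toC.symm.differentiableAt,
      toC.symm.fderiv]
    rfl
  have hdd : ∀ z e, fderiv ℝ (fun y => fderiv ℝ (W ∘ toC.symm) y e) z e =
      fderiv ℝ (fun q => fderiv ℝ W q (toC.symm e)) (toC.symm z) (toC.symm e) := by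
    intro z e
    have : (fun y => fderiv ℝ (W ∘ toC.symm) y e) =
        (fun q => fderiv ℝ W q (toC.symm e)) ∘ toC.symm := by
      ext y
      exact hd y e
    have h1 : Differentiable ℝ (fun q => fderiv ℝ W q (toC.symm e)) :=
      ((hW.fderiv_right (m := 1) (by norm_num)).differentiable one_ne_zero).clm_apply
        (differentiable_const _)
    rw [this, fderiv_comp z (h1 _) toC.symm.differentiableAt, toC.symm.fderiv]
    rfl
  have h2 : ∀ z e, iteratedFDeriv ℝ 2 (W ∘ toC.symm) z ![e, e] =
      fderiv ℝ (fun y => fderiv ℝ (W ∘ toC.symm) y e) z e := by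
    intro z e
    have h1 : DifferentiableAt ℝ (fderiv ℝ (W ∘ toC.symm)) z :=
      ((hc.fderiv_right (m := 1) (by norm_num)).differentiable one_ne_zero) z
    rw [iteratedFDeriv_two_apply, fderiv_clm_apply h1 (differentiableAt_const _)]
    simp
  intro z _
  refine ⟨hc.contDiffAt, Filter.Eventually.of_forall fun y => ?_⟩
  rw [InnerProductSpace.laplacian_eq_iteratedFDeriv_complexPlane]
  simp only [h2, hdd, toC_symm_one, toC_symm_I, Pi.zero_apply]
  simpa [Fin.sum_univ_two] using hh (toC.symm y)

theorem gradient_re_eval_toC (p : Polynomial ℂ) (q : E2) :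
    gradient (fun q => (p.eval (toC q)).re) q =
      toC.symm (starRingEnd ℂ (p.derivative.eval (toC q))) := by
  refine HasGradientAt.gradient ?_
  rw [hasGradientAt_iff_hasFDerivAt]
  have h1 := ((p.hasDerivAt (toC q)).hasFDerivAt.restrictScalars ℝ).comp q
    toC.toContinuousLinearEquiv.hasFDerivAt
  have h2 := Complex.reCLM.hasFDerivAt.comp q h1
  refine h2.congr_fderiv ?_
  ext h
  rw [InnerProductSpace.toDual_apply_apply, ← toC.inner_map_map, toC.apply_symm_apply,
    Complex.inner]
  simp

/-- A polynomial in two variables grows at most like the power given by its total degree. -/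
theorem exists_eval_le_mul_one_add_norm_pow (P : MvPolynomial (Fin 2) ℝ) :
    ∃ C, ∀ q : E2, MvPolynomial.eval (fun i => q i) P ≤ C * (1 + ‖q‖) ^ P.totalDegree := by
  refine ⟨∑ d ∈ P.support, |P.coeff d|, fun q => ?_⟩
  rw [MvPolynomial.eval_eq', Finset.sum_mul]
  refine Finset.sum_le_sum fun d hd => (le_abs_self _).trans ?_
  rw [abs_mul, Finset.abs_prod]
  refine mul_le_mul_of_nonneg_left ?_ (abs_nonneg _)
  have h1 : ∏ i, |q i ^ d i| ≤ ∏ i, (1 + ‖q‖) ^ d i := by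
    refine Finset.prod_le_prod (fun i _ => abs_nonneg _) fun i _ => ?_
    rw [abs_pow]
    have : |q i| ≤ ‖q‖ := PiLp.norm_apply_le q i
    gcongr
    linarith
  refine h1.trans ?_
  rw [Finset.prod_pow_eq_pow_sum]
  refine pow_le_pow_right₀ (by linarith [norm_nonneg q]) ?_
  have := MvPolynomial.le_totalDegree hd
  rwa [Finsupp.sum_fintype _ _ (fun _ => rfl)] at this

theorem Harmonic2.exists_polynomial {W : E2 → ℝ} (hW : ContDiff ℝ 2 W) (hh : Harmonic2 W)
    {P : MvPolynomial (Fin 2) ℝ} (hP : ∀ q : E2, W q ≤ MvPolynomial.eval (fun i => q i) P) :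
    ∃ p : Polynomial ℂ, p.natDegree ≤ P.totalDegree ∧ (p.coeff 0).im = 0 ∧
      ∀ q, W q = (p.eval (toC q)).re := by
  obtain ⟨C, hC⟩ := exists_eval_le_mul_one_add_norm_pow P
  obtain ⟨p, h1, h2, h3⟩ := exists_polynomial_re_eq_of_le (C := C) (N := P.totalDegree)
    (Harmonic2.harmonicOnNhd_comp_toC_symm hW hh) (fun z => by
      simpa using (hP (toC.symm z)).trans (hC (toC.symm z)))
  exact ⟨p, h1, h2, fun q => by simpa using h3 (toC q)⟩

/-- The real part of a complex polynomial of degree at most two is a real polynomial of total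
degree at most two. -/
theorem exists_mvPolynomial_of_natDegree_le_two {p : Polynomial ℂ} (hp : p.natDegree ≤ 2) :
    ∃ P : MvPolynomial (Fin 2) ℝ, P.totalDegree ≤ 2 ∧
      ∀ q : E2, (p.eval (toC q)).re = MvPolynomial.eval (fun i => q i) P := by
  let c (n : ℕ) (x y : ℝ) : MvPolynomial (Fin 2) ℝ :=
    MvPolynomial.C x * MvPolynomial.X 0 ^ n + MvPolynomial.C y * MvPolynomial.X 1 ^ n
  have hc : ∀ n, n ≤ 2 → ∀ x y, (c n x y).totalDegree ≤ 2 := by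
    intro n hn x y
    refine (MvPolynomial.totalDegree_add _ _).trans (max_le ?_ ?_) <;>
    · refine (MvPolynomial.totalDegree_mul _ _).trans ?_
      rw [MvPolynomial.totalDegree_C, MvPolynomial.totalDegree_X_pow]
      omega
  refine ⟨c 0 (p.coeff 0).re 0 + c 1 (p.coeff 1).re (-(p.coeff 1).im)
    + c 2 (p.coeff 2).re (-(p.coeff 2).re)
    + MvPolynomial.C (-2 * (p.coeff 2).im) * (MvPolynomial.X 0 * MvPolynomial.X 1), ?_, ?_⟩
  · refine (MvPolynomial.totalDegree_add _ _).trans (max_le ?_ ?_)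
    · refine (MvPolynomial.totalDegree_add _ _).trans (max_le ?_ (hc 2 le_rfl _ _))
      exact (MvPolynomial.totalDegree_add _ _).trans
        (max_le (hc 0 (by norm_num) _ _) (hc 1 (by norm_num) _ _))
    · refine (MvPolynomial.totalDegree_mul _ _).trans ?_
      rw [MvPolynomial.totalDegree_C, zero_add]
      refine (MvPolynomial.totalDegree_mul _ _).trans ?_
      rw [MvPolynomial.totalDegree_X, MvPolynomial.totalDegree_X]
  · intro q
    rw [Polynomial.eval_eq_sum_range' (n := 3) (by omega)]
    simp [Finset.sum_range_succ, c, toC, Complex.orthonormalBasisOneI_repr_symm_apply, pow_two]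
    ring

/-- The first-order vector field on phase space associated with `q̈ = F (u, q)`. -/
def phaseField (F : ℝ → E2 → E2) (t : ℝ) (x : E2 × E2) : E2 × E2 := (x.2, F t x.1)

theorem phaseField_lipschitzOnWith {F : ℝ → E2 → E2} {t : ℝ} {K : NNReal} {A : Set E2}
    {B : Set (E2 × E2)} (hF : LipschitzOnWith K (F t) A) (hBA : ∀ x ∈ B, x.1 ∈ A) :
    LipschitzOnWith (max 1 K) (phaseField F t) B := by
  refine LipschitzOnWith.of_dist_le_mul fun x hx y hy => ?_
  rw [NNReal.coe_max, NNReal.coe_one, Prod.dist_eq (x := phaseField F t x)]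
  refine max_le ?_ ?_
  · have h1 : dist x.2 y.2 ≤ dist x y := le_max_right _ _
    show dist x.2 y.2 ≤ max 1 (K : ℝ) * dist x y
    nlinarith [le_max_left 1 (K : ℝ), dist_nonneg (x := x) (y := y)]
  · have h1 : dist x.1 y.1 ≤ dist x y := le_max_left _ _
    refine (hF.dist_le_mul _ (hBA x hx) _ (hBA y hy)).trans ?_
    exact mul_le_mul (le_max_right _ _) h1 dist_nonneg (by positivity)

theorem SolOn.hasDerivAt_prodMk {F : ℝ → E2 → E2} {q v : ℝ → E2} {s : Set ℝ}
    (h : SolOn F q v s) {t : ℝ} (ht : t ∈ s) :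
    HasDerivAt (fun t => (q t, v t)) (phaseField F t (q t, v t)) t :=
  (h t ht).1.prodMk (h t ht).2

/-- Local existence for `q̈ = F (u, q)` on an explicit interval. -/
theorem exists_solOn_Ioo {F : ℝ → E2 → E2} {t₁ δ a B : ℝ} {K : NNReal} {q₀ v₀ : E2}
    (hδ : 0 < δ) (ha : 0 ≤ a) (hcont : ∀ q, Continuous fun t => F t q)
    (hlip : ∀ t ∈ Icc (t₁ - δ) (t₁ + δ), LipschitzOnWith K (F t) (Metric.closedBall q₀ a))
    (hB : ∀ t ∈ Icc (t₁ - δ) (t₁ + δ), ∀ q ∈ Metric.closedBall q₀ a, ‖F t q‖ ≤ B)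
    (hvδ : (‖v₀‖ + a) * δ ≤ a) (hBδ : B * δ ≤ a) :
    ∃ q v : ℝ → E2, q t₁ = q₀ ∧ v t₁ = v₀ ∧ SolOn F q v (Ioo (t₁ - δ) (t₁ + δ)) := by
  have ht₁ : t₁ ∈ Icc (t₁ - δ) (t₁ + δ) := ⟨by linarith, by linarith⟩
  have hva : 0 ≤ ‖v₀‖ + a := by positivity
  have hfst : ∀ x ∈ Metric.closedBall (q₀, v₀) a, x.1 ∈ Metric.closedBall q₀ a := fun x hx =>
    show dist x.1 q₀ ≤ a from (le_max_left _ _).trans (show dist x (q₀, v₀) ≤ a from hx)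
  have hpl : IsPicardLindelof (phaseField F) ⟨t₁, ht₁⟩ (q₀, v₀) ⟨a, ha⟩ 0
      (max (‖v₀‖ + a) B).toNNReal (max 1 K) := by
    refine ⟨fun t ht => phaseField_lipschitzOnWith (hlip t ht) hfst, fun x _ => ?_,
      fun t ht x hx => ?_, ?_⟩
    · exact (continuous_const.prodMk (hcont x.1)).continuousOn
    · rw [Real.coe_toNNReal _ (hva.trans (le_max_left _ _))]
      refine max_le_max ?_ (hB t ht _ (hfst x hx))
      have h1 : dist x.2 v₀ ≤ a := (le_max_right _ _).trans hx
      rw [dist_eq_norm] at h1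
      show ‖x.2‖ ≤ _
      calc ‖x.2‖ = ‖v₀ + (x.2 - v₀)‖ := by simp
        _ ≤ ‖v₀‖ + a := (norm_add_le _ _).trans (by linarith)
    · rw [Real.coe_toNNReal _ (hva.trans (le_max_left _ _))]
      simp only [add_sub_cancel_left, sub_sub_cancel, max_self, NNReal.coe_zero, sub_zero]
      rw [max_mul_of_nonneg _ _ hδ.le]
      exact max_le hvδ hBδ
  obtain ⟨x, hx0, hx⟩ := hpl.exists_eq_forall_mem_Icc_hasDerivWithinAt₀
  refine ⟨fun t => (x t).1, fun t => (x t).2, by simp [hx0], by simp [hx0], fun t ht => ?_⟩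
  have h := (hx t (Ioo_subset_Icc_self ht)).hasDerivAt (Icc_mem_nhds ht.1 ht.2)
  exact ⟨(hasFDerivAt_fst.comp_hasDerivAt t h :), (hasFDerivAt_snd.comp_hasDerivAt t h :)⟩

/-- A solution on an open interval, as an element of the preorder of extensions. -/
structure IntervalSol (F : ℝ → E2 → E2) where
  dom : Set ℝ
  pos : ℝ → E2
  vel : ℝ → E2
  isOpen : IsOpen dom
  ordConnected : dom.OrdConnected
  solOn : SolOn F pos vel dom

instance (F : ℝ → E2 → E2) : Preorder (IntervalSol F) where
  le a b := a.dom ⊆ b.dom ∧ ∀ t ∈ a.dom, b.pos t = a.pos t ∧ b.vel t = a.vel t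
  le_refl a := ⟨subset_rfl, fun _ _ => ⟨rfl, rfl⟩⟩
  le_trans a b c hab hbc := ⟨hab.1.trans hbc.1, fun t ht =>
    ⟨(hbc.2 t (hab.1 ht)).1.trans (hab.2 t ht).1, (hbc.2 t (hab.1 ht)).2.trans (hab.2 t ht).2⟩⟩

theorem IntervalSol.bddAbove_of_isChain {F : ℝ → E2 → E2} {c : Set (IntervalSol F)}
    (hc : IsChain (· ≤ ·) c) {a₀ : IntervalSol F} (ha₀ne : a₀.dom.Nonempty)
    (hle : ∀ a ∈ c, a₀ ≤ a) : BddAbove c := by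
  classical
  let D : Set ℝ := ⋃ a ∈ c, a.dom
  have hD : ∀ t, t ∈ D ↔ ∃ a ∈ c, t ∈ a.dom := fun t => by simp [D]
  let Q (t : ℝ) : E2 := if h : ∃ a ∈ c, t ∈ a.dom then h.choose.pos t else 0
  let U (t : ℝ) : E2 := if h : ∃ a ∈ c, t ∈ a.dom then h.choose.vel t else 0
  have hQ : ∀ a ∈ c, ∀ t ∈ a.dom, Q t = a.pos t ∧ U t = a.vel t := by
    intro a ha t ht
    have h : ∃ a ∈ c, t ∈ a.dom := ⟨a, ha, ht⟩
    have hs := h.choose_spec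
    simp only [Q, U, dif_pos h]
    rcases hc.total ha hs.1 with h1 | h1
    · exact h1.2 t ht
    · exact ⟨(h1.2 t hs.2).1.symm, (h1.2 t hs.2).2.symm⟩
  have hDo : IsOpen D := isOpen_biUnion fun a _ => a.isOpen
  have hsol : SolOn F Q U D := by
    intro t ht
    obtain ⟨a, ha, hta⟩ := (hD t).1 ht
    have hn : a.dom ∈ nhds t := a.isOpen.mem_nhds hta
    have e1 : Q =ᶠ[nhds t] a.pos := Filter.mem_of_superset hn fun r hr => (hQ a ha r hr).1
    have e2 : U =ᶠ[nhds t] a.vel := Filter.mem_of_superset hn fun r hr => (hQ a ha r hr).2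
    have hs := a.solOn t hta
    rw [(hQ a ha t hta).1, (hQ a ha t hta).2]
    exact ⟨hs.1.congr_of_eventuallyEq e1, hs.2.congr_of_eventuallyEq e2⟩
  obtain ⟨t₀, ht₀⟩ := ha₀ne
  have hDc : D.OrdConnected := by
    have : IsPreconnected D := by
      refine isPreconnected_of_forall t₀ fun y hy => ?_
      obtain ⟨a, ha, hya⟩ := (hD y).1 hy
      exact ⟨a.dom, fun r hr => (hD r).2 ⟨a, ha, hr⟩, (hle a ha).1 ht₀, hya,
        a.ordConnected.isPreconnected⟩
    exact this.ordConnected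
  exact ⟨⟨D, Q, U, hDo, hDc, hsol⟩, fun a ha => ⟨fun r hr => (hD r).2 ⟨a, ha, hr⟩, hQ a ha⟩⟩

/-- Every solution on an open interval extends to a maximal one. -/
theorem SolOn.exists_isMaximalSolution {F : ℝ → E2 → E2} {q v : ℝ → E2} {s : Set ℝ}
    (hs : SolOn F q v s) (ho : IsOpen s) (hc : s.OrdConnected) (hne : s.Nonempty) :
    ∃ (s' : Set ℝ) (q' v' : ℝ → E2), IsMaximalSolution F q' v' s' ∧ s ⊆ s' ∧
      ∀ t ∈ s, q' t = q t ∧ v' t = v t := by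
  let a₀ : IntervalSol F := ⟨s, q, v, ho, hc, hs⟩
  obtain ⟨m, hm0, hm⟩ := zorn_le_nonempty₀ (Ici a₀) (fun c hca hcc y hy => by
    have hchain : IsChain (· ≤ ·) (insert a₀ c) :=
      hcc.insert fun b hb _ => Or.inl (hca hb)
    obtain ⟨b, hb⟩ := IntervalSol.bddAbove_of_isChain hchain (a₀ := a₀) hne (by
      rintro a (rfl | ha)
      · exact le_rfl
      · exact hca ha)
    exact ⟨b, hb (mem_insert _ _), fun z hz => hb (mem_insert_of_mem _ hz)⟩) a₀ (mem_Ici.2 le_rfl)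
  refine ⟨m.dom, m.pos, m.vel, ⟨m.isOpen, m.ordConnected, hne.mono hm0.1, m.solOn, ?_⟩,
    hm0.1, hm0.2⟩
  intro s' q' v' ho' hc' hss hsol heq
  have hle : m ≤ ⟨s', q', v', ho', hc', hsol⟩ := ⟨hss, heq⟩
  exact (hm.2 (hm0.trans hle) hle).1.antisymm hss

theorem SolOn.mono {F : ℝ → E2 → E2} {q v : ℝ → E2} {s s' : Set ℝ} (h : SolOn F q v s)
    (hs : s' ⊆ s) : SolOn F q v s' := fun t ht => h t (hs ht)

/-- Solutions of a globally Lipschitz second-order equation are unique on open intervals. -/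
theorem SolOn.eq_of_lipschitzWith {F : ℝ → E2 → E2} {q v q' v' : ℝ → E2} {s : Set ℝ}
    (ho : IsOpen s) (hc : s.OrdConnected) {K : NNReal} (hK : ∀ t ∈ s, LipschitzWith K (F t))
    (h : SolOn F q v s) (h' : SolOn F q' v' s) {t₁ : ℝ} (ht₁ : t₁ ∈ s) (hq : q t₁ = q' t₁)
    (hv : v t₁ = v' t₁) {t : ℝ} (ht : t ∈ s) : q t = q' t ∧ v t = v' t := by
  have hmin : min t₁ t ∈ s := by rcases min_choice t₁ t with e | e <;> rwa [e]
  have hmax : max t₁ t ∈ s := by rcases max_choice t₁ t with e | e <;> rwa [e]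
  obtain ⟨a, has, ha⟩ : ∃ a ∈ s, a < min t₁ t := by
    obtain ⟨a, ha, hs⟩ := mem_nhdsLE_iff_exists_Icc_subset.1
      (mem_nhdsWithin_of_mem_nhds (ho.mem_nhds hmin))
    exact ⟨a, hs ⟨le_rfl, ha.le⟩, ha⟩
  obtain ⟨b, hbs, hb⟩ : ∃ b ∈ s, max t₁ t < b := by
    obtain ⟨b, hb, hs⟩ := mem_nhdsGE_iff_exists_Icc_subset.1
      (mem_nhdsWithin_of_mem_nhds (ho.mem_nhds hmax))
    exact ⟨b, hs ⟨hb.le, le_rfl⟩, hb⟩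
  have hsub : Ioo a b ⊆ s := Ioo_subset_Icc_self.trans (hc.out has hbs)
  have key := ODE_solution_unique_of_mem_Ioo (v := phaseField F) (s := fun _ => univ)
    (K := max 1 K) (a := a) (b := b) (t₀ := t₁) (f := fun t => (q t, v t))
    (g := fun t => (q' t, v' t))
    (fun t ht => phaseField_lipschitzOnWith (hK t (hsub ht)).lipschitzOnWith
      (A := univ) fun _ _ => trivial)
    ⟨ha.trans_le (min_le_left _ _), (le_max_left _ _).trans_lt hb⟩
    (fun t ht => ⟨h.hasDerivAt_prodMk (hsub ht), trivial⟩)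
    (fun t ht => ⟨h'.hasDerivAt_prodMk (hsub ht), trivial⟩) (by simp [hq, hv])
    (show t ∈ Ioo a b from
      ⟨ha.trans_le (min_le_right _ _), (le_max_right _ _).trans_lt hb⟩)
  exact Prod.ext_iff.1 key

/-- Maximal solutions of a second-order equation that is globally Lipschitz in position, locally
uniformly in time, are complete. -/
theorem IsMaximalSolution.eq_univ_of_lipschitzWith {F : ℝ → E2 → E2}
    (hcont : ∀ q, Continuous fun t => F t q)
    (hlip : ∀ T : ℝ, ∃ K : NNReal, ∀ t ∈ Icc (-T) T, LipschitzWith K (F t))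
    {q v : ℝ → E2} {s : Set ℝ} (h : IsMaximalSolution F q v s) : s = univ := by
  classical
  obtain ⟨ho, hc, hne, hsol, hmax⟩ := h
  by_contra hs
  have hcl : ¬ IsClosed s := fun hcl => (isClopen_iff.1 ⟨hcl, ho⟩).elim hne.ne_empty hs
  obtain ⟨b, hb, hbs⟩ : ∃ b ∈ closure s, b ∉ s := by
    by_contra! hsub
    exact hcl (isClosed_of_closure_subset hsub)
  obtain ⟨K, hK⟩ := hlip (|b| + 2)
  obtain ⟨M, hM⟩ := (isCompact_Icc (a := -(|b| + 2)) (b := |b| + 2)).exists_bound_of_continuousOn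
    (hcont 0).continuousOn
  have hM0 : 0 ≤ M := (norm_nonneg _).trans
    (hM 0 ⟨by linarith [abs_nonneg b], by linarith [abs_nonneg b]⟩)
  set δ := 1 / (M + 2 * K + 2) with hδ
  have hK0 : (0 : ℝ) ≤ K := K.2
  have hδ0 : 0 < δ := by positivity
  have hδM : (M + 2 * K + 2) * δ = 1 := by rw [hδ]; field_simp
  have hδ2 : δ * 2 ≤ 1 := by nlinarith
  obtain ⟨t₁, ht₁, hbt⟩ := Metric.mem_closure_iff.1 hb δ hδ0
  rw [Real.dist_eq, abs_lt] at hbt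
  have hJ : Icc (t₁ - δ) (t₁ + δ) ⊆ Icc (-(|b| + 2)) (|b| + 2) := fun t ht =>
    ⟨by linarith [ht.1, neg_abs_le b], by linarith [ht.2, le_abs_self b]⟩
  have ha : 0 ≤ ‖q t₁‖ + ‖v t₁‖ + 1 := by positivity
  obtain ⟨Q, U, hQ, hU, hQU⟩ := exists_solOn_Ioo (F := F) (t₁ := t₁) (δ := δ)
    (a := ‖q t₁‖ + ‖v t₁‖ + 1)
    (B := (M + 2 * K) * (‖q t₁‖ + ‖v t₁‖ + 1)) (K := K) (q₀ := q t₁) (v₀ := v t₁) hδ0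
    ha hcont (fun t ht => (hK t (hJ ht)).lipschitzOnWith)
    (fun t ht x hx => by
      have h1 := (hK t (hJ ht)).dist_le_mul x 0
      rw [dist_eq_norm, dist_zero_right] at h1
      have h2 := hM t (hJ ht)
      have h3 : ‖x‖ ≤ ‖q t₁‖ + (‖q t₁‖ + ‖v t₁‖ + 1) := by
        rw [mem_closedBall_iff_norm] at hx
        have := norm_add_le (q t₁) (x - q t₁)
        rw [add_sub_cancel] at this
        linarith
      have h4 : ‖F t x‖ ≤ ‖F t x - F t 0‖ + ‖F t 0‖ := norm_le_norm_sub_add _ _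
      nlinarith [norm_nonneg (q t₁), norm_nonneg (v t₁)])
    (by nlinarith [norm_nonneg (q t₁), norm_nonneg (v t₁)])
    (by nlinarith)
  set J := Ioo (t₁ - δ) (t₁ + δ) with hJdef
  have ht₁J : t₁ ∈ J := ⟨by linarith, by linarith⟩
  have hbJ : b ∈ J := ⟨by linarith, by linarith⟩
  have hEq : ∀ t ∈ s ∩ J, q t = Q t ∧ v t = U t := fun t ht =>
    SolOn.eq_of_lipschitzWith (ho.inter isOpen_Ioo) (hc.inter ordConnected_Ioo)
      (fun t ht => hK t (hJ (Ioo_subset_Icc_self ht.2))) (hsol.mono inter_subset_left)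
      (hQU.mono inter_subset_right) ⟨ht₁, ht₁J⟩ hQ.symm hU.symm ht
  have hsJ : s ∪ J = s := by
    refine hmax (s ∪ J) (s.piecewise q Q) (s.piecewise v U) (ho.union isOpen_Ioo) ?_
      subset_union_left ?_ fun t ht => by simp [ht]
    · exact (hc.isPreconnected.union t₁ ht₁ ht₁J ordConnected_Ioo.isPreconnected).ordConnected
    · intro t ht
      by_cases hts : t ∈ s
      · have e : ∀ f g : ℝ → E2, s.piecewise f g =ᶠ[nhds t] f := fun f g =>
          Filter.mem_of_superset (ho.mem_nhds hts) fun r hr => by simp [hr]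
        rw [piecewise_eq_of_mem _ _ _ hts, piecewise_eq_of_mem _ _ _ hts]
        exact ⟨(hsol t hts).1.congr_of_eventuallyEq (e _ _),
          (hsol t hts).2.congr_of_eventuallyEq (e _ _)⟩
      · have htJ : t ∈ J := ht.resolve_left hts
        have e1 : s.piecewise q Q =ᶠ[nhds t] Q :=
          Filter.mem_of_superset (isOpen_Ioo.mem_nhds htJ) fun r hr => by
            by_cases hrs : r ∈ s
            · simpa [hrs] using (hEq r ⟨hrs, hr⟩).1
            · simp [hrs]
        have e2 : s.piecewise v U =ᶠ[nhds t] U :=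
          Filter.mem_of_superset (isOpen_Ioo.mem_nhds htJ) fun r hr => by
            by_cases hrs : r ∈ s
            · simpa [hrs] using (hEq r ⟨hrs, hr⟩).2
            · simp [hrs]
        rw [piecewise_eq_of_notMem _ _ _ hts, piecewise_eq_of_notMem _ _ _ hts]
        exact ⟨(hQU t htJ).1.congr_of_eventuallyEq e1, (hQU t htJ).2.congr_of_eventuallyEq e2⟩
  exact hbs (hsJ ▸ Or.inr hbJ)

/-- Growth estimate for the radial quantities `r = ‖q‖`, `P = ⟪q, q̇⟫` and the energy `H` of a
trajectory escaping along a direction in which the potential decreases like `-r ^ (2 * β)`. -/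
theorem le_and_le_of_radial_inequalities {β κ C A R t₁ T : ℝ} {r P H P' H' : ℝ → ℝ}
    (hβ : 1 < β) (hκ : 0 < κ) (hC : 0 ≤ C) (hA : 0 ≤ A) (hCA : C ≤ A * (β + 1) * (κ / 2))
    (hAT : 2 * β * A * (T - t₁) ≤ κ / 8) (hR : 1 < R) (hRC : 2 * C / κ / R ≤ κ / 8)
    (hT : t₁ ≤ T) (hrc : ContinuousOn r (Icc t₁ T))
    (hr : ∀ t ∈ Ioo t₁ T, 1 < r t → HasDerivAt r (P t / r t) t)
    (hP : ∀ t ∈ Icc t₁ T, HasDerivAt P (P' t) t)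
    (hH : ∀ t ∈ Icc t₁ T, HasDerivAt H (H' t) t)
    (hP' : ∀ t ∈ Ioo t₁ T, 1 < r t →
      (β + 1) * P t ^ 2 / r t ^ 2 - 2 * β * H t - C * r t ^ (2 * β - 1) ≤ P' t)
    (hH' : ∀ t ∈ Ioo t₁ T, 1 < r t → H' t ≤ C * r t ^ (2 * β))
    (hr₁ : r t₁ = R) (hP₁ : P t₁ = κ * R ^ (β + 1)) (hH₁ : H t₁ ≤ 0)
    (hgood : ∀ t ∈ Ioo t₁ T, 1 < r t ∧ κ / 2 * r t ^ (β + 1) < P t) :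
    R ≤ r T ∧ 3 / 4 * κ * r T ^ (β + 1) ≤ P T := by
  have ht₁ : t₁ ∈ Icc t₁ T := ⟨le_rfl, hT⟩
  have hTT : T ∈ Icc t₁ T := ⟨hT, le_rfl⟩
  have hrmono : MonotoneOn r (Icc t₁ T) := by
    refine monotoneOn_of_hasDerivWithinAt_nonneg (convex_Icc _ _) hrc (f' := fun t => P t / r t)
      (fun t ht => ?_) fun t ht => ?_
    all_goals rw [interior_Icc] at ht; obtain ⟨h1, h2⟩ := hgood t ht
    · exact (hr t ht h1).hasDerivWithinAt
    · have : 0 < r t ^ (β + 1) := by positivity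
      have : 0 < P t := by nlinarith
      positivity
  have hrR : ∀ t ∈ Icc t₁ T, R ≤ r t := fun t ht => hr₁ ▸ hrmono ht₁ ht ht.1
  have hr0 : ∀ t ∈ Icc t₁ T, 0 < r t := fun t ht => by linarith [hrR t ht]
  have hpow : ContinuousOn (fun t => r t ^ (β + 1)) (Icc t₁ T) :=
    hrc.rpow_const fun t ht => Or.inl (hr0 t ht).ne'
  have hHc : ContinuousOn H (Icc t₁ T) := fun t ht =>
    (hH t ht).continuousAt.continuousWithinAt
  have hHle : ∀ t ∈ Icc t₁ T, H t ≤ A * r t ^ (β + 1) := by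
    have hanti : AntitoneOn (fun t => H t - A * r t ^ (β + 1)) (Icc t₁ T) := by
      refine antitoneOn_of_hasDerivWithinAt_nonpos (convex_Icc _ _)
        (hHc.sub (continuousOn_const.mul hpow))
        (f' := fun t => H' t - A * (P t / r t * (β + 1) * r t ^ (β + 1 - 1)))
        (fun t ht => ?_) fun t ht => ?_
      all_goals rw [interior_Icc] at ht; obtain ⟨h1, h2⟩ := hgood t ht
      · exact ((hH t (Ioo_subset_Icc_self ht)).sub
          (((hr t ht h1).rpow_const (Or.inl (by linarith))).const_mul A)).hasDerivWithinAt
      · have h0 : 0 < r t := by linarith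
        have e1 : r t ^ (β + 1) = r t ^ β * r t := Real.rpow_add_one h0.ne' _
        have e2 : r t ^ (2 * β) = r t ^ β * r t ^ β := by rw [two_mul, Real.rpow_add h0]
        have h3 := hH' t ht h1
        rw [e1] at h2
        rw [e2] at h3
        have hx : 0 < r t ^ β := by positivity
        have h4 : κ / 2 * r t ^ β < P t / r t := by rw [lt_div_iff₀ h0]; linarith
        rw [add_sub_cancel_right]
        have h5 : C * r t ^ β ≤ A * (β + 1) * (P t / r t) := by
          calc C * r t ^ β ≤ A * (β + 1) * (κ / 2) * r t ^ β := by gcongr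
            _ = A * (β + 1) * (κ / 2 * r t ^ β) := by ring
            _ ≤ _ := by gcongr
        nlinarith
    intro t ht
    have h := hanti ht₁ ht ht.1
    simp only [hr₁] at h
    have : 0 ≤ A * R ^ (β + 1) := by positivity
    linarith
  refine ⟨hrR T hTT, ?_⟩
  have hmono : MonotoneOn (fun t => P t / r t ^ (β + 1) + 2 * β * A * t - 2 * C / κ / r t)
      (Icc t₁ T) := by
    have hPc : ContinuousOn P (Icc t₁ T) := fun t ht =>
      (hP t ht).continuousAt.continuousWithinAt
    refine monotoneOn_of_hasDerivWithinAt_nonneg (convex_Icc _ _)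
      (((hPc.div hpow fun t ht => (Real.rpow_pos_of_pos (hr0 t ht) _).ne').add
        (continuousOn_const.mul continuousOn_id)).sub
        (continuousOn_const.div hrc fun t ht => (hr0 t ht).ne'))
      (f' := fun t => (P' t * r t ^ (β + 1) - P t * (P t / r t * (β + 1) * r t ^ (β + 1 - 1))) /
        (r t ^ (β + 1)) ^ 2 + 2 * β * A * 1 - (0 * r t - 2 * C / κ * (P t / r t)) / r t ^ 2)
      (fun t ht => ?_) fun t ht => ?_
    all_goals rw [interior_Icc] at ht; obtain ⟨h1, h2⟩ := hgood t ht
    · have hrt := hr t ht h1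
      exact ((((hP t (Ioo_subset_Icc_self ht)).div (hrt.rpow_const (Or.inl (by linarith)))
        (by positivity)).add ((hasDerivAt_id t).const_mul _)).sub
        ((hasDerivAt_const t _).div hrt (by positivity))).hasDerivWithinAt
    · have h0 : 0 < r t := by linarith
      have hx : 0 < r t ^ β := by positivity
      have e1 : r t ^ (β + 1) = r t ^ β * r t := Real.rpow_add_one h0.ne' _
      have e2 : r t ^ (2 * β - 1) = r t ^ β * r t ^ β / r t := by
        rw [Real.rpow_sub_one h0.ne', two_mul, Real.rpow_add h0]
      have h3 := hP' t ht h1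
      have h4 := hHle t (Ioo_subset_Icc_self ht)
      rw [add_sub_cancel_right, e1]
      rw [e1] at h2 h4
      rw [e2] at h3
      set x := r t ^ β
      set ρ := r t
      have e3 : (P' t * (x * ρ) - P t * (P t / ρ * (β + 1) * x)) / (x * ρ) ^ 2 + 2 * β * A * 1 -
          (0 * ρ - 2 * C / κ * (P t / ρ)) / ρ ^ 2 =
          (P' t - (β + 1) * P t ^ 2 / ρ ^ 2 + 2 * β * A * (x * ρ)
            + C * (x * x / ρ) * (P t / (κ / 2 * (x * ρ)))) / (x * ρ) := by
        field_simp
        ring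
      rw [e3]
      have h5 : 1 ≤ P t / (κ / 2 * (x * ρ)) := by
        rw [one_le_div (by positivity)]
        exact h2.le
      have h6 : C * (x * x / ρ) ≤ C * (x * x / ρ) * (P t / (κ / 2 * (x * ρ))) :=
        le_mul_of_one_le_right (by positivity) h5
      have h7 : 2 * β * H t ≤ 2 * β * (A * (x * ρ)) := by gcongr
      exact div_nonneg (by linarith) (by positivity)
  have h := hmono ht₁ hTT hT
  have hRp : 0 < R ^ (β + 1) := by positivity
  simp only [hr₁, hP₁, mul_div_assoc, div_self hRp.ne', mul_one] at h
  have hrT := hr0 T hTT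
  have h1 : 0 ≤ 2 * (C / κ) / r T := by positivity
  have h2 : 2 * (C / κ) / R ≤ κ / 8 := by rwa [mul_div_assoc] at hRC
  rw [← le_div_iff₀ (by positivity)]
  simp only [← mul_div_assoc] at *
  nlinarith

/-- The radial inequalities of a trajectory escaping along a direction in which the potential
decreases like `-r ^ (2 * β)`, `β > 1`, cannot hold on a whole interval if the trajectory starts
far away. -/
theorem false_of_radial_inequalities {β κ C A R t₁ δ : ℝ} {r P H P' H' : ℝ → ℝ}
    (hβ : 1 < β) (hκ : 0 < κ) (hC : 0 ≤ C) (hA : 0 ≤ A) (hCA : C ≤ A * (β + 1) * (κ / 2))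
    (hδ : 0 ≤ δ) (hAδ : 2 * β * A * δ ≤ κ / 8) (hR : 1 < R) (hRC : 2 * C / κ / R ≤ κ / 8)
    (hRδ : R ^ (1 - β) ≤ (β - 1) * (κ / 2) * δ)
    (hrc : ContinuousOn r (Icc t₁ (t₁ + δ)))
    (hr : ∀ t ∈ Icc t₁ (t₁ + δ), 1 < r t → HasDerivAt r (P t / r t) t)
    (hP : ∀ t ∈ Icc t₁ (t₁ + δ), HasDerivAt P (P' t) t)
    (hH : ∀ t ∈ Icc t₁ (t₁ + δ), HasDerivAt H (H' t) t)
    (hP' : ∀ t ∈ Icc t₁ (t₁ + δ), 1 < r t →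
      (β + 1) * P t ^ 2 / r t ^ 2 - 2 * β * H t - C * r t ^ (2 * β - 1) ≤ P' t)
    (hH' : ∀ t ∈ Icc t₁ (t₁ + δ), 1 < r t → H' t ≤ C * r t ^ (2 * β))
    (hr₁ : r t₁ = R) (hP₁ : P t₁ = κ * R ^ (β + 1)) (hH₁ : H t₁ ≤ 0) : False := by
  have hPc : ContinuousOn P (Icc t₁ (t₁ + δ)) := fun t ht =>
    (hP t ht).continuousAt.continuousWithinAt
  have hgood : ∀ t ∈ Icc t₁ (t₁ + δ), 1 < r t ∧ κ / 2 * r t ^ (β + 1) < P t := by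
    by_contra! hbad
    set S := Icc t₁ (t₁ + δ) ∩
      {t | min (r t - 1) (P t - κ / 2 * r t ^ (β + 1)) ∈ Iic (0 : ℝ)} with hS
    have hScl : IsClosed S := by
      refine ContinuousOn.preimage_isClosed_of_isClosed ?_ isClosed_Icc isClosed_Iic
      exact (hrc.sub continuousOn_const).inf (hPc.sub (continuousOn_const.mul
        (hrc.rpow_const fun _ _ => Or.inr (by linarith))))
    have hSne : S.Nonempty := by
      obtain ⟨t, ht, h⟩ := hbad
      refine ⟨t, ht, ?_⟩
      rw [mem_ofPred_eq, mem_Iic, min_le_iff]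
      by_cases h1 : 1 < r t
      · exact Or.inr (by linarith [h h1])
      · exact Or.inl (by linarith)
    have hSb : BddBelow S := ⟨t₁, fun t ht => ht.1.1⟩
    obtain ⟨hT, hTS⟩ := hScl.csInf_mem hSne hSb
    set T := sInf S
    have hsub : Icc t₁ T ⊆ Icc t₁ (t₁ + δ) := Icc_subset_Icc_right hT.2
    have hsub' : Ioo t₁ T ⊆ Icc t₁ (t₁ + δ) := Ioo_subset_Icc_self.trans hsub
    obtain ⟨h1, h2⟩ := le_and_le_of_radial_inequalities hβ hκ hC hA hCA
      (le_trans (by gcongr; linarith [hT.2]) hAδ) hR hRC hT.1 (hrc.mono hsub)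
      (fun t ht => hr t (hsub' ht)) (fun t ht => hP t (hsub ht)) (fun t ht => hH t (hsub ht))
      (fun t ht => hP' t (hsub' ht)) (fun t ht => hH' t (hsub' ht)) hr₁ hP₁ hH₁
      (fun t ht => by
        have h : t ∉ S := notMem_of_lt_csInf ht.2 hSb
        rw [hS, mem_inter_iff, not_and, mem_ofPred_eq, mem_Iic, not_le, lt_min_iff] at h
        obtain ⟨h1, h2⟩ := h (hsub' ht)
        exact ⟨by linarith, by linarith⟩)
    rw [mem_ofPred_eq, mem_Iic, min_le_iff] at hTS
    have : 0 < r T ^ (β + 1) := Real.rpow_pos_of_pos (by linarith) _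
    rcases hTS with h | h
    · linarith
    · nlinarith
  have ht₁ : t₁ ∈ Icc t₁ (t₁ + δ) := ⟨le_rfl, by linarith⟩
  have hTT : t₁ + δ ∈ Icc t₁ (t₁ + δ) := ⟨by linarith, le_rfl⟩
  have hanti : AntitoneOn (fun t => r t ^ (1 - β) + (β - 1) * (κ / 2) * t)
      (Icc t₁ (t₁ + δ)) := by
    refine antitoneOn_of_hasDerivWithinAt_nonpos (convex_Icc _ _)
      ((hrc.rpow_const fun t ht => Or.inl (by linarith [(hgood t ht).1])).add
        (continuousOn_const.mul continuousOn_id))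
      (f' := fun t => P t / r t * (1 - β) * r t ^ (1 - β - 1) + (β - 1) * (κ / 2) * 1)
      (fun t ht => ?_) fun t ht => ?_
    all_goals
      replace ht := interior_subset ht
      obtain ⟨h1, h2⟩ := hgood t ht
    · exact (((hr t ht h1).rpow_const (Or.inl (by linarith))).add
        ((hasDerivAt_id t).const_mul _)).hasDerivWithinAt
    · have h0 : 0 < r t := by linarith
      have e1 : r t ^ (1 - β - 1) = (r t ^ β)⁻¹ := by
        rw [sub_right_comm, sub_self, zero_sub, Real.rpow_neg h0.le]
      rw [Real.rpow_add_one h0.ne'] at h2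
      rw [e1]
      have hx : 0 < r t ^ β := by positivity
      have h3 : κ / 2 < P t / r t * (r t ^ β)⁻¹ := by
        rw [← div_eq_mul_inv, div_div, lt_div_iff₀ (by positivity)]
        linarith
      nlinarith
  have h := hanti ht₁ hTT (by linarith)
  simp only [hr₁] at h
  have : 0 < r (t₁ + δ) ^ (1 - β) := Real.rpow_pos_of_pos (by linarith [(hgood _ hTT).1]) _
  linarith

section Potential

variable {V : ℝ → E2 → ℝ}

theorem hasDerivAt_potential (hC1 : ContDiff ℝ 1 fun p : ℝ × E2 => V p.1 p.2) (u : ℝ) (q : E2) :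
    HasDerivAt (fun t => V t q) (fderiv ℝ (fun p : ℝ × E2 => V p.1 p.2) (u, q) (1, 0)) u := by
  have h := (hC1.differentiable one_ne_zero (u, q)).hasFDerivAt
  exact h.comp_hasDerivAt (f := fun t => (t, q)) u ((hasDerivAt_id u).prodMk (hasDerivAt_const u q))

theorem fderiv_potential (hC1 : ContDiff ℝ 1 fun p : ℝ × E2 => V p.1 p.2) (u : ℝ) (q : E2) :
    fderiv ℝ (V u) q = (fderiv ℝ (fun p : ℝ × E2 => V p.1 p.2) (u, q)).comp
      (ContinuousLinearMap.inr ℝ ℝ E2) := by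
  have h := (hC1.differentiable one_ne_zero (u, q)).hasFDerivAt
  exact (h.comp (f := fun x => (u, x)) q (hasFDerivAt_prodMk_right u q)).fderiv

theorem continuous_gradient_potential (hC1 : ContDiff ℝ 1 fun p : ℝ × E2 => V p.1 p.2) :
    Continuous fun p : ℝ × E2 => gradient (V p.1) p.2 := by
  have h : Continuous fun p : ℝ × E2 => fderiv ℝ (V p.1) p.2 := by
    simp_rw [fderiv_potential hC1]
    exact (hC1.continuous_fderiv one_ne_zero).clm_comp continuous_const
  exact (InnerProductSpace.toDual ℝ E2).symm.continuous.comp h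

theorem hasDerivAt_potential_comp (hC1 : ContDiff ℝ 1 fun p : ℝ × E2 => V p.1 p.2)
    {q : ℝ → E2} {w : E2} {t : ℝ} (hq : HasDerivAt q w t) :
    HasDerivAt (fun t => V t (q t))
      (deriv (fun u => V u (q t)) t + inner ℝ (gradient (V t) (q t)) w) t := by
  have h := (hC1.differentiable one_ne_zero (t, q t)).hasFDerivAt
  have h' := h.comp_hasDerivAt (f := fun t => (t, q t)) t ((hasDerivAt_id t).prodMk hq)
  refine HasDerivAt.congr_deriv (f' := _) h' ?_
  rw [(hasDerivAt_potential hC1 t (q t)).deriv, gradient, InnerProductSpace.toDual_symm_apply,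
    fderiv_potential hC1, ContinuousLinearMap.comp_apply, ← map_add]
  simp

/-- If the potential decreases like `-r ^ (2 * β)`, `β > 1`, along a ray, with suitable control of
its time derivative and of its homogeneity, then some maximal trajectory is incomplete. -/
theorem exists_isMaximalSolution_ne_univ (hC1 : ContDiff ℝ 1 fun p : ℝ × E2 => V p.1 p.2)
    {β C h u₁ δ₀ R₁ : ℝ} {e : E2} (hβ : 1 < β) (hC : 0 ≤ C) (hh : 0 < h) (hδ₀ : 0 < δ₀)
    (he : ‖e‖ = 1)
    (hVu : ∀ t ∈ Icc u₁ (u₁ + δ₀), ∀ q, 1 < ‖q‖ →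
      deriv (fun u => V u q) t ≤ C * ‖q‖ ^ (2 * β))
    (hVq : ∀ t ∈ Icc u₁ (u₁ + δ₀), ∀ q, 1 < ‖q‖ →
      inner ℝ q (gradient (V t) q) ≤ 2 * β * V t q + C * ‖q‖ ^ (2 * β - 1))
    (hV : ∀ R ≥ R₁, V u₁ (R • e) ≤ -h * R ^ (2 * β))
    (hlip : ∀ ρ : ℝ, ∃ K : NNReal, ∀ t ∈ Icc (u₁ - δ₀) (u₁ + δ₀),
      LipschitzOnWith K (fun q => -gradient (V t) q) (Metric.closedBall 0 ρ)) :
    ∃ q v s, IsMaximalSolution (fun u p => -gradient (V u) p) q v s ∧ s ≠ univ := by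
  set κ := min 1 h with hκdef
  have hκ : 0 < κ := lt_min one_pos hh
  have hκh : κ ^ 2 ≤ h := by nlinarith [min_le_left 1 h, min_le_right 1 h]
  set A := 2 * C / ((β + 1) * κ) with hA
  have hA0 : 0 ≤ A := by positivity
  have hCA : C ≤ A * (β + 1) * (κ / 2) := by rw [hA]; field_simp; rfl
  set δ := min δ₀ (κ / (16 * (β * A + 1))) with hδdef
  have hδ : 0 < δ := lt_min hδ₀ (by positivity)
  have hAδ : 2 * β * A * δ ≤ κ / 8 := by
    have h1 : δ ≤ κ / (16 * (β * A + 1)) := min_le_right _ _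
    rw [le_div_iff₀ (by positivity)] at h1
    nlinarith
  obtain ⟨R, hR, hRR₁, hRC, hRδ⟩ : ∃ R : ℝ, 1 < R ∧ R₁ ≤ R ∧ 2 * C / κ / R ≤ κ / 8 ∧
      R ^ (1 - β) ≤ (β - 1) * (κ / 2) * δ := by
    have h1 : Filter.Tendsto (fun R : ℝ => 2 * C / κ / R) Filter.atTop (nhds 0) :=
      Filter.Tendsto.div_atTop tendsto_const_nhds Filter.tendsto_id
    have h2 : Filter.Tendsto (fun R : ℝ => R ^ (1 - β)) Filter.atTop (nhds 0) := by
      simpa using tendsto_rpow_neg_atTop (y := β - 1) (by linarith)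
    have h3 : 0 < (β - 1) * (κ / 2) * δ :=
      mul_pos (mul_pos (by linarith) (by positivity)) hδ
    exact ((Filter.eventually_gt_atTop 1).and ((Filter.eventually_ge_atTop R₁).and
      ((h1.eventually_le_const (by positivity)).and (h2.eventually_le_const h3)))).exists
  have hR0 : 0 < R := by linarith
  have hcont := continuous_gradient_potential hC1
  obtain ⟨B, hB⟩ := (isCompact_Icc.prod
    (isCompact_closedBall (R • e) 1)).exists_bound_of_continuousOn
    (s := Icc (u₁ - δ₀) (u₁ + δ₀) ×ˢ Metric.closedBall (R • e) 1) hcont.continuousOn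
  have hB0 : 0 ≤ B := (norm_nonneg _).trans (hB (u₁, R • e)
    ⟨⟨by linarith, by linarith⟩, Metric.mem_closedBall_self zero_le_one⟩)
  obtain ⟨K, hK⟩ := hlip (R + 1)
  set w := (κ * R ^ β) • e with hw
  set d := min δ₀ (1 / (‖w‖ + 1 + B)) with hd
  have hd0 : 0 < d := lt_min hδ₀ (by positivity)
  have hdB : d * (‖w‖ + 1 + B) ≤ 1 := by
    rw [← le_div_iff₀ (by positivity)]; exact min_le_right _ _
  have hdsub : Icc (u₁ - d) (u₁ + d) ⊆ Icc (u₁ - δ₀) (u₁ + δ₀) :=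
    Icc_subset_Icc (by linarith [min_le_left δ₀ (1 / (‖w‖ + 1 + B))])
      (by linarith [min_le_left δ₀ (1 / (‖w‖ + 1 + B))])
  have hball : Metric.closedBall (R • e) 1 ⊆ Metric.closedBall 0 (R + 1) := by
    refine Metric.closedBall_subset_closedBall' ?_
    rw [dist_zero_right, norm_smul, he, Real.norm_of_nonneg hR0.le]
    linarith
  obtain ⟨q₀, v₀, hq₀, hv₀, hsol₀⟩ := exists_solOn_Ioo (F := fun u p => -gradient (V u) p)
    (t₁ := u₁) (a := 1) (B := B) (K := K) (v₀ := w) hd0 zero_le_one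
    (fun q => (hcont.comp (continuous_id.prodMk continuous_const)).neg)
    (fun t ht => (hK t (hdsub ht)).mono hball)
    (fun t ht q hq => by rw [norm_neg]; exact hB (t, q) ⟨hdsub ht, hq⟩)
    (by nlinarith) (by nlinarith [norm_nonneg w])
  have hu₁ : u₁ ∈ Ioo (u₁ - d) (u₁ + d) := ⟨by linarith, by linarith⟩
  obtain ⟨s, q, v, hmax, -, heq⟩ := hsol₀.exists_isMaximalSolution isOpen_Ioo ordConnected_Ioo
    ⟨u₁, hu₁⟩
  refine ⟨q, v, s, hmax, fun hs => ?_⟩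
  have hsol : ∀ t, HasDerivAt q (v t) t ∧ HasDerivAt v (-gradient (V t) (q t)) t := fun t =>
    hmax.2.2.2.1 t (hs ▸ mem_univ t)
  have hq₁ : q u₁ = R • e := (heq u₁ hu₁).1.trans hq₀
  have hv₁ : v u₁ = w := (heq u₁ hu₁).2.trans hv₀
  have hqn : ‖q u₁‖ = R := by rw [hq₁, norm_smul, he, Real.norm_of_nonneg hR0.le, mul_one]
  have hvn : ‖v u₁‖ ^ 2 = κ ^ 2 * R ^ (2 * β) := by
    rw [hv₁, hw, norm_smul, he, Real.norm_of_nonneg (by positivity), two_mul,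
      Real.rpow_add hR0]
    ring
  have hsub : Icc u₁ (u₁ + δ) ⊆ Icc u₁ (u₁ + δ₀) :=
    Icc_subset_Icc_right (by linarith [min_le_left δ₀ (κ / (16 * (β * A + 1)))])
  refine false_of_radial_inequalities (r := fun t => ‖q t‖) (P := fun t => inner ℝ (q t) (v t))
    (H := fun t => ‖v t‖ ^ 2 / 2 + V t (q t)) (t₁ := u₁)
    (P' := fun t => inner ℝ (q t) (-gradient (V t) (q t)) + inner ℝ (v t) (v t))
    (H' := fun t => deriv (fun u => V u (q t)) t)
    hβ hκ hC hA0 hCA hδ.le hAδ hR hRC hRδ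
    (fun t _ => (hsol t).1.continuousAt.norm.continuousWithinAt) (fun t _ ht => ?_)
    (fun t _ => (hsol t).1.inner ℝ (hsol t).2) (fun t _ => ?_) (fun t ht h1 => ?_)
    (fun t ht h1 => hVu t (hsub ht) _ h1) hqn ?_ ?_
  · have h1 : HasDerivAt (fun t => √(‖q t‖ ^ 2)) _ t :=
      (hsol t).1.norm_sq.sqrt (by positivity)
    simp only [Real.sqrt_sq (norm_nonneg _)] at h1
    convert h1 using 1
    rw [mul_div_mul_left _ _ two_ne_zero]
  · have h1 := ((hsol t).2.norm_sq.div_const 2).add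
      (hasDerivAt_potential_comp hC1 (hsol t).1)
    refine h1.congr_deriv ?_
    rw [inner_neg_right, real_inner_comm (v t)]
    ring
  · have h2 := hVq t (hsub ht) _ h1
    have h3 : (inner ℝ (q t) (v t)) ^ 2 / ‖q t‖ ^ 2 ≤ ‖v t‖ ^ 2 := by
      rw [div_le_iff₀ (by positivity), ← mul_pow, ← sq_abs, mul_comm]
      exact pow_le_pow_left₀ (abs_nonneg _) (abs_real_inner_le_norm _ _) 2
    rw [inner_neg_right, real_inner_self_eq_norm_sq, mul_div_assoc]
    have h4 := mul_le_mul_of_nonneg_left h3 (by linarith : 0 ≤ β + 1)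
    linarith
  · show inner ℝ (q u₁) (v u₁) = _
    rw [hq₁, hv₁, hw, real_inner_smul_left, real_inner_smul_right, real_inner_self_eq_norm_sq, he,
      Real.rpow_add_one hR0.ne']
    ring
  · have h1 := hV R hRR₁
    have h2 : 0 < R ^ (2 * β) := by positivity
    show ‖v u₁‖ ^ 2 / 2 + V u₁ (q u₁) ≤ 0
    rw [hvn, hq₁]
    nlinarith

end Potential

theorem inner_gradient_re_eval_toC (p : Polynomial ℂ) (q : E2) :
    inner ℝ q (gradient (fun q => (p.eval (toC q)).re) q) =
      (toC q * p.derivative.eval (toC q)).re := by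
  rw [gradient_re_eval_toC, ← toC.inner_map_map, LinearIsometryEquiv.apply_symm_apply,
    Complex.inner, ← map_mul, Complex.conj_re,
    mul_comm]

theorem norm_eval_le_of_norm_coeff_le {p : Polynomial ℂ} {n : ℕ} {M : ℝ} (hp : p.natDegree ≤ n)
    (hM : ∀ j ≤ n, ‖p.coeff j‖ ≤ M) {z : ℂ} (hz : 1 ≤ ‖z‖) :
    ‖p.eval z‖ ≤ (n + 1) * M * ‖z‖ ^ n := by
  rw [Polynomial.eval_eq_sum_range' (Nat.lt_succ_of_le hp)]
  calc ‖∑ j ∈ Finset.range (n + 1), p.coeff j * z ^ j‖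
      ≤ ∑ j ∈ Finset.range (n + 1), M * ‖z‖ ^ n := by
        refine norm_sum_le_of_le _ fun j hj => ?_
        have hj : j ≤ n := Nat.lt_succ_iff.1 (Finset.mem_range.1 hj)
        rw [norm_mul, norm_pow]
        have := hM j hj
        have : 0 ≤ M := (norm_nonneg _).trans this
        gcongr
    _ = _ := by simp; ring

theorem re_mul_eval_derivative_le {p : Polynomial ℂ} {n : ℕ} {M : ℝ} (hp : p.natDegree ≤ n + 1)
    (hM : ∀ j ≤ n + 1, ‖p.coeff j‖ ≤ M) {z : ℂ} (hz : 1 ≤ ‖z‖) :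
    (z * p.derivative.eval z).re ≤
      (n + 1) * (p.eval z).re + (n + 1) * ((n + 1) * M) * ‖z‖ ^ n := by
  set g : Polynomial ℂ := Polynomial.X * p.derivative - Polynomial.C ((n : ℂ) + 1) * p with hg
  have hcoeff : ∀ j, g.coeff j = (j - (n + 1)) * p.coeff j := by
    rintro (_ | j)
    · simp [hg]
      ring
    · simp only [hg, Polynomial.coeff_sub, Polynomial.coeff_X_mul, Polynomial.coeff_derivative,
        Polynomial.coeff_C_mul]
      push_cast
      ring
  have hdeg : g.natDegree ≤ n := by
    refine Polynomial.natDegree_le_iff_coeff_eq_zero.2 fun j hj => ?_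
    rw [hcoeff]
    rcases (Nat.succ_le_of_lt hj).eq_or_lt with rfl | h
    · push_cast; ring
    · rw [Polynomial.coeff_eq_zero_of_natDegree_lt (hp.trans_lt h), mul_zero]
  have hb : ∀ j ≤ n, ‖g.coeff j‖ ≤ (n + 1) * M := fun j hj => by
    rw [hcoeff, norm_mul]
    have h1 : ‖(j : ℂ) - (n + 1)‖ ≤ n + 1 := by
      have e : (j : ℂ) - (n + 1) = ((j - (n + 1) : ℝ) : ℂ) := by push_cast; ring
      rw [e, Complex.norm_real, Real.norm_eq_abs, abs_le]
      have : (j : ℝ) ≤ n := by exact_mod_cast hj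
      exact ⟨by linarith [(j.cast_nonneg : (0 : ℝ) ≤ j)], by linarith⟩
    exact mul_le_mul h1 (hM j (by omega)) (norm_nonneg _) (by positivity)
  have h1 := (Complex.re_le_norm _).trans (norm_eval_le_of_norm_coeff_le hdeg hb hz)
  have h2 : (g.eval z).re = (z * p.derivative.eval z).re - (n + 1) * (p.eval z).re := by
    simp only [hg, Polynomial.eval_sub, Polynomial.eval_mul, Polynomial.eval_X,
      Polynomial.eval_C, Complex.sub_re]
    congr 1
    have e : ((n : ℂ) + 1) = ((n + 1 : ℝ) : ℂ) := by push_cast; ring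
    rw [e, Complex.re_ofReal_mul]
  linarith

theorem exists_lipschitzOnWith_eval_derivative (n : ℕ) (M ρ : ℝ) :
    ∃ K : NNReal, ∀ p : Polynomial ℂ, p.natDegree ≤ n → (∀ j ≤ n, ‖p.coeff j‖ ≤ M) →
      LipschitzOnWith K (fun z => p.derivative.eval z) (Metric.closedBall 0 ρ) := by
  have hs : ∀ p : Polynomial ℂ, p.natDegree ≤ n → ∀ z, p.derivative.derivative.eval z =
      ∑ j ∈ Finset.range (n + 1), p.coeff j * (j * ((j - 1 : ℕ) : ℂ)) * z ^ (j - 1 - 1) := by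
    intro p hp z
    conv_lhs => rw [p.as_sum_range' (n + 1) (Nat.lt_succ_of_le hp)]
    simp [Polynomial.derivative_monomial, Polynomial.eval_finsetSum, mul_assoc]
  refine ⟨(∑ j ∈ Finset.range (n + 1), |M| * (j * ((j - 1 : ℕ) : ℝ)) * |ρ| ^ (j - 1 - 1)).toNNReal,
    fun p hp hM => ?_⟩
  refine (convex_closedBall (0 : ℂ) ρ).lipschitzOnWith_of_nnnorm_deriv_le (𝕜 := ℂ)
    (fun z _ => p.derivative.differentiable z) fun z hz => ?_
  rw [Polynomial.deriv, hs p hp, ← NNReal.coe_le_coe, coe_nnnorm, Real.coe_toNNReal']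
  refine le_trans (norm_sum_le_of_le _ fun j hj => ?_) (le_max_left _ _)
  rw [norm_mul, norm_mul, norm_mul, norm_pow, Complex.norm_natCast, Complex.norm_natCast]
  have h1 := (hM j (Nat.lt_succ_iff.1 (Finset.mem_range.1 hj))).trans (le_abs_self M)
  have h2 : ‖z‖ ≤ |ρ| := (mem_closedBall_zero_iff.1 hz).trans (le_abs_self ρ)
  gcongr

theorem lipschitzOnWith_neg_gradient_re_eval_toC {p : Polynomial ℂ} {K : NNReal} {A : Set ℂ}
    (h : LipschitzOnWith K (fun z => p.derivative.eval z) A) {B : Set E2}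
    (hBA : ∀ q ∈ B, toC q ∈ A) :
    LipschitzOnWith K (fun q => -gradient (fun q => (p.eval (toC q)).re) q) B := by
  refine LipschitzOnWith.of_dist_le_mul fun x hx y hy => ?_
  rw [dist_neg_neg, gradient_re_eval_toC, gradient_re_eval_toC, toC.symm.dist_map,
    dist_eq_norm, ← map_sub, RCLike.norm_conj, ← dist_eq_norm, ← toC.dist_map x y]
  exact h.dist_le_mul _ (hBA x hx) _ (hBA y hy)

theorem exists_norm_eq_one_forall_re_eval_le {p : Polynomial ℂ} {n : ℕ}
    (hp : p.natDegree ≤ n + 1) (ha : p.coeff (n + 1) ≠ 0) :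
    ∃ z : ℂ, ‖z‖ = 1 ∧ ∃ h > 0, ∃ R₁ : ℝ, ∀ R ≥ R₁,
      (p.eval (R * z)).re ≤ -h * R ^ (n + 1) := by
  set a := p.coeff (n + 1) with hadef
  have hna : (‖a‖ : ℂ) ≠ 0 := by exact_mod_cast norm_ne_zero_iff.2 ha
  obtain ⟨z, hz⟩ := IsAlgClosed.exists_pow_nat_eq (-(starRingEnd ℂ a) / ‖a‖) n.succ_pos
  have hz1 : ‖z‖ = 1 := by
    rw [← pow_eq_one_iff_of_nonneg (norm_nonneg z) n.succ_ne_zero, ← norm_pow, hz, norm_div,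
      norm_neg, RCLike.norm_conj, Complex.norm_real, norm_norm, div_self (norm_ne_zero_iff.2 ha)]
  have haz : a * z ^ (n + 1) = -(‖a‖ : ℂ) := by
    rw [hz, mul_div_assoc', mul_neg, Complex.mul_conj, Complex.normSq_eq_norm_sq]
    field_simp
    push_cast
    ring
  set M := ∑ j ∈ Finset.range (n + 1), ‖p.coeff j‖ with hM
  have hM0 : 0 ≤ M := Finset.sum_nonneg fun _ _ => norm_nonneg _
  have ha0 : 0 < ‖a‖ := norm_pos_iff.2 ha
  refine ⟨z, hz1, ‖a‖ / 2, by positivity, max 1 (2 * M / ‖a‖), fun R hR => ?_⟩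
  have hR1 : 1 ≤ R := (le_max_left _ _).trans hR
  have hR2 : 2 * M ≤ R * ‖a‖ := by
    rw [← div_le_iff₀ ha0]; exact (le_max_right _ _).trans hR
  have hsum : ‖∑ j ∈ Finset.range (n + 1), p.coeff j * (R * z) ^ j‖ ≤ M * R ^ n := by
    rw [hM, Finset.sum_mul]
    refine norm_sum_le_of_le _ fun j hj => ?_
    rw [norm_mul, norm_pow, norm_mul, hz1, mul_one, Complex.norm_real,
      Real.norm_of_nonneg (by linarith)]
    have := Nat.lt_succ_iff.1 (Finset.mem_range.1 hj)
    gcongr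
  have hlead : (p.coeff (n + 1) * (R * z) ^ (n + 1)).re = -‖a‖ * R ^ (n + 1) := by
    have e : p.coeff (n + 1) * ((R : ℂ) * z) ^ (n + 1) = ((-‖a‖ * R ^ (n + 1) : ℝ) : ℂ) := by
      rw [mul_pow, mul_left_comm, ← hadef, haz]
      push_cast
      ring
    rw [e, Complex.ofReal_re]
  rw [Polynomial.eval_eq_sum_range' (Nat.lt_succ_of_le hp), Finset.sum_range_succ, Complex.add_re,
    hlead]
  have h1 := (Complex.re_le_norm _).trans hsum
  have h2 : M * R ^ n ≤ ‖a‖ / 2 * R ^ (n + 1) := by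
    rw [pow_succ']
    have : 0 < R ^ n := by positivity
    nlinarith
  linarith

section Family

variable {V : ℝ → E2 → ℝ} {p : ℝ → Polynomial ℂ}

theorem exists_norm_coeff_le (hV : Continuous fun x : ℝ × E2 => V x.1 x.2)
    (hp : ∀ u q, V u q = ((p u).eval (toC q)).re) (h0 : ∀ u, ((p u).coeff 0).im = 0)
    (a b : ℝ) (n : ℕ) : ∃ M, ∀ u ∈ Icc a b, ∀ j ≤ n, ‖(p u).coeff j‖ ≤ M := by
  obtain ⟨M, hM⟩ := (isCompact_Icc.prod (isCompact_closedBall 0 1)).exists_bound_of_continuousOn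
    (s := Icc a b ×ˢ Metric.closedBall (0 : E2) 1) hV.continuousOn
  refine ⟨2 ^ (n + 2) * |M|, fun u hu j hj => ?_⟩
  refine (norm_coeff_le_of_abs_re_eval_le (h0 u) (M := |M|) (fun z hz => ?_) j).trans ?_
  · have h := hM (u, toC.symm z) ⟨hu, by simpa using hz⟩
    simp only [hp, LinearIsometryEquiv.apply_symm_apply, Real.norm_eq_abs] at h
    exact h.trans (le_abs_self M)
  · gcongr
    norm_num

theorem exists_norm_coeff_sub_le (hV : ContDiff ℝ 1 fun x : ℝ × E2 => V x.1 x.2)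
    (hp : ∀ u q, V u q = ((p u).eval (toC q)).re) (h0 : ∀ u, ((p u).coeff 0).im = 0)
    (a b : ℝ) (n : ℕ) : ∃ L ≥ 0, ∀ u ∈ Icc a b, ∀ u' ∈ Icc a b, ∀ j ≤ n,
      ‖(p u' - p u).coeff j‖ ≤ L * |u' - u| := by
  have hc : Continuous fun x : ℝ × E2 =>
      fderiv ℝ (fun x : ℝ × E2 => V x.1 x.2) x ((1, 0) : ℝ × E2) :=
    (hV.continuous_fderiv one_ne_zero).clm_apply continuous_const
  obtain ⟨M, hM⟩ := (isCompact_Icc.prod (isCompact_closedBall 0 1)).exists_bound_of_continuousOn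
    (s := Icc a b ×ˢ Metric.closedBall (0 : E2) 1) hc.continuousOn
  refine ⟨2 ^ (n + 2) * |M|, by positivity, fun u hu u' hu' j hj => ?_⟩
  refine (norm_coeff_le_of_abs_re_eval_le (p := p u' - p u) (M := |M| * |u' - u|)
    (by simp [h0]) (fun z hz => ?_) j).trans ?_
  · have h := (convex_Icc a b).norm_image_sub_le_of_norm_hasDerivWithin_le
      (f := fun t => V t (toC.symm z)) (C := |M|)
      (fun t _ => (hasDerivAt_potential hV t (toC.symm z)).hasDerivWithinAt)
      (fun t ht => (hM (t, toC.symm z) ⟨ht, by simpa using hz⟩).trans (le_abs_self M)) hu hu'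
    simpa [hp] using h
  · rw [mul_assoc]
    gcongr
    norm_num

theorem abs_deriv_potential_le (hp : ∀ u q, V u q = ((p u).eval (toC q)).re) {n : ℕ} {L : ℝ}
    (hL0 : 0 ≤ L) {a b : ℝ} (hdeg : ∀ u ∈ Icc a b, (p u).natDegree ≤ n)
    (hL : ∀ u ∈ Icc a b, ∀ u' ∈ Icc a b, ∀ j ≤ n, ‖(p u' - p u).coeff j‖ ≤ L * |u' - u|)
    {t : ℝ} (ht : t ∈ Ioo a b) {q : E2} (hq : 1 ≤ ‖q‖) :
    |deriv (fun u => V u q) t| ≤ (n + 1) * L * ‖q‖ ^ n := by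
  rw [← Real.norm_eq_abs]
  refine norm_deriv_le_of_lip' (𝕜 := ℝ) (by positivity) ?_
  filter_upwards [Icc_mem_nhds ht.1 ht.2] with u hu
  have ht' := Ioo_subset_Icc_self ht
  have h := norm_eval_le_of_norm_coeff_le
    (Polynomial.natDegree_sub_le_of_le (hdeg u hu) (hdeg t ht') |>.trans (max_self n).le)
    (hL t ht' u hu) (z := toC q) (by rwa [toC.norm_map])
  rw [toC.norm_map] at h
  rw [hp, hp, ← Complex.sub_re, ← Polynomial.eval_sub]
  refine ((Complex.abs_re_le_norm _).trans h).trans (le_of_eq ?_)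
  rw [Real.norm_eq_abs]
  ring

end Family

theorem eq_of_re_eval_toC_eq {p p' : Polynomial ℂ} (h0 : (p.coeff 0).im = 0)
    (h0' : (p'.coeff 0).im = 0) (h : ∀ q, (p.eval (toC q)).re = (p'.eval (toC q)).re) :
    p = p' := by
  ext j
  have h1 := norm_coeff_le_of_abs_re_eval_le (p := p - p') (M := 0) (by simp [h0, h0'])
    (fun z _ => by simpa [sub_eq_zero] using h (toC.symm z)) j
  rw [mul_zero, norm_le_zero_iff, Polynomial.coeff_sub, sub_eq_zero] at h1
  exact h1

theorem PolynomiallyUBounded.exists_polynomial {V : ℝ → E2 → ℝ} (hV : PolynomiallyUBounded V)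
    (hC2 : ∀ u, ContDiff ℝ 2 (V u)) (hh : ∀ u, Harmonic2 (V u)) :
    ∃ p : ℝ → Polynomial ℂ, (∀ u q, V u q = ((p u).eval (toC q)).re) ∧
      (∀ u, ((p u).coeff 0).im = 0) ∧
      ∀ u₀, ∃ ε > 0, ∃ N : ℕ, ∀ u, |u - u₀| < ε → (p u).natDegree ≤ N := by
  have hex : ∀ u, ∃ p : Polynomial ℂ, (p.coeff 0).im = 0 ∧
      ∀ q, V u q = (p.eval (toC q)).re := fun u => by
    obtain ⟨ε, hε, P, hP⟩ := hV u
    obtain ⟨p, -, h⟩ := (hh u).exists_polynomial (hC2 u) fun q => hP u q (by simpa using hε)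
    exact ⟨p, h⟩
  choose p h0 hp using hex
  refine ⟨p, hp, h0, fun u₀ => ?_⟩
  obtain ⟨ε, hε, P, hP⟩ := hV u₀
  refine ⟨ε, hε, P.totalDegree, fun u hu => ?_⟩
  obtain ⟨g, hg, hg0, hgV⟩ := (hh u).exists_polynomial (hC2 u) fun q => hP u q hu
  rwa [eq_of_re_eval_toC_eq (h0 u) hg0 fun q => (hp u q).symm.trans (hgV q)]

theorem lipschitzWith_eval_derivative {p : Polynomial ℂ} (hp : p.natDegree ≤ 2) {M : ℝ}
    (hM : ‖p.coeff 2‖ ≤ M) :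
    LipschitzWith (2 * M).toNNReal fun z => p.derivative.eval z := by
  refine LipschitzWith.of_dist_le_mul fun x y => ?_
  have h : ∀ z, p.derivative.eval z = p.coeff 1 + 2 * p.coeff 2 * z := fun z => by
    conv_lhs => rw [p.as_sum_range' 3 (Nat.lt_succ_of_le hp)]
    simp only [Finset.sum_range_succ, Finset.sum_range_zero, Polynomial.derivative_add,
      Polynomial.derivative_monomial, Polynomial.eval_add, Polynomial.eval_monomial,
      Polynomial.derivative_zero, Polynomial.eval_zero]
    push_cast
    ring
  have e : p.coeff 1 + 2 * p.coeff 2 * x - (p.coeff 1 + 2 * p.coeff 2 * y) =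
      2 * p.coeff 2 * (x - y) := by ring
  rw [h, h, dist_eq_norm, dist_eq_norm, e, norm_mul, norm_mul, Complex.norm_ofNat,
    Real.coe_toNNReal']
  gcongr
  exact le_trans (by linarith) (le_max_left _ _)

theorem exists_isMaximalSolution_ne_univ_of_natDegree {V : ℝ → E2 → ℝ} {p : ℝ → Polynomial ℂ}
    (hC1 : ContDiff ℝ 1 fun x : ℝ × E2 => V x.1 x.2)
    (hp : ∀ u q, V u q = ((p u).eval (toC q)).re) (h0 : ∀ u, ((p u).coeff 0).im = 0)
    {u₁ ε : ℝ} (hε : 0 < ε) {n : ℕ} (hn : 2 ≤ n) (hdeg₁ : (p u₁).natDegree = n + 1)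
    (hdeg : ∀ u ∈ Icc (u₁ - ε) (u₁ + ε), (p u).natDegree ≤ n + 1) :
    ∃ q v s, IsMaximalSolution (fun u p => -gradient (V u) p) q v s ∧ s ≠ univ := by
  have hVeq : ∀ u, V u = fun q => ((p u).eval (toC q)).re := fun u => funext (hp u)
  obtain ⟨M, hM⟩ := exists_norm_coeff_le hC1.continuous hp h0 (u₁ - ε) (u₁ + ε) (n + 1)
  obtain ⟨L, hL0, hL⟩ := exists_norm_coeff_sub_le hC1 hp h0 (u₁ - ε) (u₁ + ε) (n + 1)
  have hu₁ : u₁ ∈ Icc (u₁ - ε) (u₁ + ε) := ⟨by linarith, by linarith⟩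
  have hM0 : 0 ≤ M := (norm_nonneg _).trans (hM u₁ hu₁ 0 (by omega))
  obtain ⟨z, hz, h, hh, R₁, hR₁⟩ := exists_norm_eq_one_forall_re_eval_le hdeg₁.le (by
    rw [← hdeg₁, Polynomial.coeff_natDegree, Polynomial.leadingCoeff_ne_zero]
    rintro h
    simp [h] at hdeg₁)
  have hn' : (2 : ℝ) ≤ n := by exact_mod_cast hn
  have hβ : 2 * (((n : ℝ) + 1) / 2) = ((n + 1 : ℕ) : ℝ) := by push_cast; ring
  have hβ' : 2 * (((n : ℝ) + 1) / 2) - 1 = (n : ℝ) := by ring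
  have hIcc : Icc (u₁ - ε / 2) (u₁ + ε / 2) ⊆ Ioo (u₁ - ε) (u₁ + ε) := fun t ht =>
    ⟨by linarith [ht.1], by linarith [ht.2]⟩
  have hIcc' : Icc u₁ (u₁ + ε / 2) ⊆ Icc (u₁ - ε / 2) (u₁ + ε / 2) :=
    Icc_subset_Icc_left (by linarith)
  have hC₁ : 0 ≤ ((n : ℝ) + 1 + 1) * L := by positivity
  have hC₂ : 0 ≤ ((n : ℝ) + 1) * ((n + 1) * M) := by positivity
  refine exists_isMaximalSolution_ne_univ hC1 (β := ((n : ℝ) + 1) / 2)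
    (C := (n + 1 + 1) * L + (n + 1) * ((n + 1) * M)) (h := h) (u₁ := u₁) (δ₀ := ε / 2) (R₁ := R₁)
    (e := toC.symm z) (by linarith) (by positivity) hh (by positivity) (by simpa using hz)
    (fun t ht q hq => ?_) (fun t ht q hq => ?_) (fun R hR => ?_) fun ρ => ?_
  · rw [hβ, Real.rpow_natCast]
    have h1 := abs_deriv_potential_le hp hL0 hdeg hL (hIcc (hIcc' ht)) hq.le
    push_cast at h1
    refine (le_abs_self _).trans (h1.trans ?_)
    gcongr
    linarith
  · rw [hβ', hVeq, inner_gradient_re_eval_toC, Real.rpow_natCast]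
    have ht' := Ioo_subset_Icc_self (hIcc (hIcc' ht))
    have h1 := re_mul_eval_derivative_le (hdeg t ht') (hM t ht') (z := toC q)
      (by rw [toC.norm_map]; exact hq.le)
    rw [toC.norm_map] at h1
    have h2 : 0 ≤ (n + 1 + 1) * L * ‖q‖ ^ n := by positivity
    linarith
  · rw [hβ, hp, Real.rpow_natCast, map_smul, LinearIsometryEquiv.apply_symm_apply,
      Complex.real_smul]
    exact hR₁ R hR
  · obtain ⟨K, hK⟩ := exists_lipschitzOnWith_eval_derivative (n + 1) M ρ
    refine ⟨K, fun t ht => ?_⟩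
    have ht' := Ioo_subset_Icc_self (hIcc ht)
    rw [hVeq]
    exact lipschitzOnWith_neg_gradient_re_eval_toC (hK (p t) (hdeg t ht') (hM t ht'))
      fun q hq => by simpa using hq

/-- **Flores–Sánchez (2019), polynomial Ehlers–Kundt conjecture.**  Let
`V : ℝ × ℝ² → ℝ` be a polynomially `u`-bounded `C¹` potential which is `C²`
and harmonic in `q = (x,y)`.  Then all maximal solutions of
`q̈(u) = -∇_q V(u, q(u))` are defined on all of `ℝ` if and only if `V(u, ·)`
is a polynomial of degree at most `2` for each `u`. -/
theorem flores_sanchez (V : ℝ → E2 → ℝ)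
    (hC1 : ContDiff ℝ 1 (fun p : ℝ × E2 => V p.1 p.2))
    (hC2 : ∀ u : ℝ, ContDiff ℝ 2 (V u))
    (hharm : ∀ u : ℝ, Harmonic2 (V u))
    (hpoly : PolynomiallyUBounded V) :
    (∀ (q v : ℝ → E2) (s : Set ℝ),
        IsMaximalSolution (fun u p => -gradient (V u) p) q v s → s = univ)
      ↔ ∀ u : ℝ, ∃ P : MvPolynomial (Fin 2) ℝ, P.totalDegree ≤ 2 ∧
          ∀ q : E2, V u q = MvPolynomial.eval (fun i => q i) P := by
  obtain ⟨p, hp, h0, hN⟩ := hpoly.exists_polynomial hC2 hharm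
  have hVeq : ∀ u, V u = fun q => ((p u).eval (toC q)).re := fun u => funext (hp u)
  constructor
  · intro hcomplete u₀
    simp_rw [hp]
    refine exists_mvPolynomial_of_natDegree_le_two ?_
    by_contra! h3
    obtain ⟨ε, hε, N, hdeg⟩ := hN u₀
    let D : Set ℕ := {d | ∃ u, |u - u₀| < ε ∧ (p u).natDegree = d}
    have hDb : BddAbove D := ⟨N, by rintro _ ⟨u, hu, rfl⟩; exact hdeg u hu⟩
    have hD₀ : (p u₀).natDegree ∈ D := ⟨u₀, by simpa using hε, rfl⟩
    obtain ⟨u₁, hu₁, hdeg₁⟩ := Nat.sSup_mem ⟨_, hD₀⟩ hDb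
    have hm := h3.trans_le (le_csSup hDb hD₀)
    obtain ⟨n, hn⟩ := Nat.exists_eq_add_of_lt hm
    obtain ⟨q, v, s, hmax, hs⟩ := exists_isMaximalSolution_ne_univ_of_natDegree hC1 hp h0
      (ε := (ε - |u₁ - u₀|) / 2) (u₁ := u₁) (n := 2 + n) (by linarith) (by omega)
      (hdeg₁.trans hn) fun u hu => by
        rw [← hn]
        refine le_csSup hDb ⟨u, ?_, rfl⟩
        have h1 : |u - u₁| ≤ (ε - |u₁ - u₀|) / 2 :=
          abs_le.2 ⟨by linarith [hu.1], by linarith [hu.2]⟩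
        linarith [abs_sub_le u u₁ u₀]
    exact hs (hcomplete q v s hmax)
  · intro hquad q v s hmax
    have hdeg : ∀ u, (p u).natDegree ≤ 2 := fun u => by
      obtain ⟨P, hP, hPV⟩ := hquad u
      obtain ⟨g, hg, hg0, hgV⟩ := (hharm u).exists_polynomial (hC2 u) fun q => (hPV q).le
      rw [eq_of_re_eval_toC_eq (h0 u) hg0 fun q => (hp u q).symm.trans (hgV q)]
      exact hg.trans hP
    refine hmax.eq_univ_of_lipschitzWith (F := fun u p => -gradient (V u) p) (fun q => ((continuous_gradient_potential hC1).comp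
      (continuous_id.prodMk continuous_const)).neg) fun T => ?_
    obtain ⟨M, hM⟩ := exists_norm_coeff_le hC1.continuous hp h0 (-T) T 2
    refine ⟨(2 * M).toNNReal, fun t ht => ?_⟩
    rw [← lipschitzOnWith_univ]
    beta_reduce
    rw [hVeq]
    exact lipschitzOnWith_neg_gradient_re_eval_toC
      (lipschitzWith_eval_derivative (hdeg t) (hM t ht 2 le_rfl)).lipschitzOnWith
      fun _ _ => mem_univ _

end
end

section
/- Let V : ℝ² → ℝ be harmonic, and suppose there exist A > 0, R > 0 and n ∈ ℕ such that V(x,y) ≤ A·(x² + y²)^{n/2} whenever x² + y² ≥ R². Then V is a (harmonic) polynomial of degree at most n. -/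
open Set

noncomputable section

open InnerProductSpace in
theorem Harmonic2.harmonicOnNhd_comp_complex {V : E2 → ℝ} (hV : Harmonic2 V)
    (hC2 : ContDiff ℝ 2 V) :
    HarmonicOnNhd (V ∘ Complex.orthonormalBasisOneI.repr) (univ : Set ℂ) := by
  intro z _
  set L := Complex.orthonormalBasisOneI.repr with hL
  refine ⟨(hC2.comp L.contDiff).contDiffAt, Filter.Eventually.of_forall fun w => ?_⟩
  have key : ∀ v, fderiv ℝ (fun q => fderiv ℝ V q v) (L w) v =
      iteratedFDeriv ℝ 2 V (L w) ![v, v] := by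
    intro v
    have hd : DifferentiableAt ℝ (fderiv ℝ V) (L w) :=
      (hC2.fderiv_right (m := 1) (by norm_num)).differentiable one_ne_zero _
    rw [iteratedFDeriv_two_apply, fderiv_clm_apply hd (differentiableAt_const v)]
    simp
  have h := hV (L w)
  simp only [key] at h
  have hcomp : ∀ i, iteratedFDeriv ℝ 2 (V ∘ L) w
      ![Complex.orthonormalBasisOneI i, Complex.orthonormalBasisOneI i] =
      iteratedFDeriv ℝ 2 V (L w) ![EuclideanSpace.single i 1, EuclideanSpace.single i 1] := by
    intro i
    have := L.toContinuousLinearEquiv.toContinuousLinearMap.iteratedFDeriv_comp_right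
      (i := 2) hC2 w le_rfl
    have e : (V ∘ L) = V ∘ L.toContinuousLinearEquiv.toContinuousLinearMap := rfl
    rw [e, this, ContinuousMultilinearMap.compContinuousLinearMap_apply]
    congr 1
    ext j : 1
    fin_cases j <;> exact Complex.orthonormalBasisOneI.repr_self i
  rw [laplacian_eq_iteratedFDeriv_orthonormalBasis _ Complex.orthonormalBasisOneI]
  simpa only [hcomp, Pi.zero_apply] using h

/-- An entire function whose real part is bounded above by a polynomial of degree `n` in `‖z‖`
has vanishing Taylor coefficients above degree `n`. -/
theorem Differentiable.iteratedDeriv_zero_eq_zero_of_re_le {F : ℂ → ℂ} (hF : Differentiable ℂ F)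
    {A C : ℝ} (hA : 0 < A) (hC : 0 ≤ C) {n k : ℕ} (hnk : n < k)
    (hb : ∀ z, (F z).re ≤ A * ‖z‖ ^ n + C) : iteratedDeriv k F 0 = 0 := by
  set K : ℝ := k.factorial * (2 * (A * 2 ^ n + C) + 3 * ‖F 0‖)
  have hK : ∀ ρ : ℝ, 1 ≤ ρ → ‖iteratedDeriv k F 0‖ ≤ K / ρ := by
    intro ρ hρ
    have hρ0 : 0 < ρ := by linarith
    have hsphere : ∀ z ∈ Metric.sphere (0 : ℂ) ρ,
        ‖F z‖ ≤ (2 * (A * 2 ^ n + C) + 3 * ‖F 0‖) * ρ ^ n := by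
      intro z hz
      have hzρ : ‖z‖ = ρ := by simpa using hz
      have hBC := Complex.borelCaratheodory (f := F) (M := A * (2 * ρ) ^ n + C) (R := 2 * ρ)
        (z := z) (by positivity) hF.differentiableOn
        (fun w hw => (hb w).trans (by
          have : ‖w‖ < 2 * ρ := by simpa using hw
          gcongr)) (by positivity) (by simp [hzρ]; linarith)
      rw [hzρ] at hBC
      have h1 : 2 * (A * (2 * ρ) ^ n + C) * ρ / (2 * ρ - ρ) + ‖F 0‖ * (2 * ρ + ρ) / (2 * ρ - ρ) =
          2 * (A * (2 * ρ) ^ n + C) + 3 * ‖F 0‖ := by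
        have : 2 * ρ - ρ = ρ := by ring
        rw [this]; field_simp; ring
      rw [h1, mul_pow] at hBC
      have h2 : 1 ≤ ρ ^ n := one_le_pow₀ hρ
      nlinarith [norm_nonneg (F 0), mul_nonneg hC (sub_nonneg.2 h2),
        mul_nonneg (norm_nonneg (F 0)) (sub_nonneg.2 h2)]
    refine (Complex.norm_iteratedDeriv_le_of_forall_mem_sphere_norm_le k hρ0 hF.diffContOnCl
      hsphere).trans ?_
    rw [← mul_assoc, div_le_div_iff₀ (by positivity) hρ0, mul_assoc, ← pow_succ]
    gcongr
    exact hnk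
  have hlim : Filter.Tendsto (fun ρ : ℝ => K / ρ) Filter.atTop (nhds 0) :=
    Filter.tendsto_id.const_div_atTop K
  exact norm_le_zero_iff.1 <| ge_of_tendsto hlim <|
    (Filter.eventually_ge_atTop 1).mono hK

theorem exists_mvPolynomial_eval_eq_re_mul_pow (k : ℕ) (a : ℂ) :
    ∃ P : MvPolynomial (Fin 2) ℝ, P.totalDegree ≤ k ∧
      ∀ z : ℂ, (a * z ^ k).re = MvPolynomial.eval ![z.re, z.im] P := by
  induction k generalizing a with
  | zero => exact ⟨MvPolynomial.C a.re, by simp, by simp⟩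
  | succ k ih =>
    obtain ⟨P, hPdeg, hP⟩ := ih a
    obtain ⟨Q, hQdeg, hQ⟩ := ih (a * Complex.I)
    refine ⟨MvPolynomial.X 0 * P + MvPolynomial.X 1 * Q, ?_, fun z => ?_⟩
    · refine (MvPolynomial.totalDegree_add _ _).trans (max_le ?_ ?_) <;>
      · refine (MvPolynomial.totalDegree_mul _ _).trans ?_
        rw [MvPolynomial.totalDegree_X]
        omega
    · simp only [map_add, map_mul, MvPolynomial.eval_X, ← hP, ← hQ]
      have : a * z ^ (k + 1) = z.re * (a * z ^ k) + z.im * (a * Complex.I * z ^ k) := by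
        conv_lhs => rw [pow_succ, ← mul_assoc]
        nth_rw 2 [← Complex.re_add_im z]
        ring
      rw [this]
      simp only [Complex.add_re, Complex.re_ofReal_mul]
      rfl

/-- **One-sided Liouville-type theorem.**  If a harmonic function
`V : ℝ² → ℝ` satisfies the one-sided bound `V(q) ≤ A·(x²+y²)^{n/2} = A·‖q‖ⁿ`
for `‖q‖ ≥ R`, then `V` is a (harmonic) polynomial of degree at most `n`. -/
theorem harmonic_one_sided_liouville (V : E2 → ℝ) (hC2 : ContDiff ℝ 2 V)
    (hharm : Harmonic2 V) (A R : ℝ) (hA : 0 < A) (hR : 0 < R) (n : ℕ)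
    (hbound : ∀ q : E2, R ^ 2 ≤ ‖q‖ ^ 2 → V q ≤ A * ‖q‖ ^ n) :
    ∃ P : MvPolynomial (Fin 2) ℝ, P.totalDegree ≤ n ∧
      ∀ q : E2, V q = MvPolynomial.eval (fun i => q i) P := by
  obtain ⟨F, hFan, hF⟩ := (hharm.harmonicOnNhd_comp_complex hC2).exists_analyticOnNhd_univ_re_eq
  set L := Complex.orthonormalBasisOneI.repr with hL
  have hFd : Differentiable ℂ F := fun z => (hFan z (mem_univ z)).differentiableAt
  have hFV : ∀ z, (F z).re = V (L z) := fun z => congrFun hF z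
  obtain ⟨C, hC⟩ := (isCompact_closedBall (0 : E2) R).exists_bound_of_continuousOn
    hC2.continuous.continuousOn
  have hC0 : 0 ≤ C := (norm_nonneg _).trans (hC 0 (by simp [hR.le]))
  have hb : ∀ z, (F z).re ≤ A * ‖z‖ ^ n + C := by
    intro z
    rw [hFV, ← L.norm_map z]
    rcases le_total R ‖L z‖ with h | h
    · linarith [hbound (L z) (by gcongr)]
    · have hle := (le_abs_self _).trans (hC (L z) (by simpa using h))
      have : 0 ≤ A * ‖L z‖ ^ n := by positivity
      linarith
  have hsum : ∀ z, F z =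
      ∑ k ∈ Finset.range (n + 1), (k.factorial : ℂ)⁻¹ * iteratedDeriv k F 0 * z ^ k := by
    intro z
    rw [← Complex.taylorSeries_eq_of_entire' 0 z hFd]
    simp only [sub_zero]
    refine tsum_eq_sum fun k hk => ?_
    rw [hFd.iteratedDeriv_zero_eq_zero_of_re_le hA hC0 (by simpa using hk) hb]
    simp
  choose P hPdeg hP using exists_mvPolynomial_eval_eq_re_mul_pow
  refine ⟨∑ k ∈ Finset.range (n + 1), P k ((k.factorial : ℂ)⁻¹ * iteratedDeriv k F 0), ?_, ?_⟩
  · refine MvPolynomial.totalDegree_finsetSum_le fun k hk => (hPdeg _ _).trans ?_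
    exact Nat.lt_succ_iff.1 (Finset.mem_range.1 hk)
  · intro q
    have hq : (fun i => q i) = ![(L.symm q).re, (L.symm q).im] := by
      obtain ⟨z, rfl⟩ := L.surjective q
      rw [L.symm_apply_apply, hL]
      ext i
      fin_cases i <;> simp [Complex.orthonormalBasisOneI_repr_apply]
    have hVq : V q = (F (L.symm q)).re := by rw [hFV, L.apply_symm_apply]
    rw [hVq, hsum, Complex.re_sum, map_sum, hq]
    exact Finset.sum_congr rfl fun k _ => hP _ _ _

end
end
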